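/- arXiv:1011.0517 — 2 statements merged into one kernel-verified Lean document; each statement's English description precedes it below -/
import Mathlib

section
/- Let ℓ ≥ 6 and let P be an ℓ-pseudo-triangle in the plane. Then the vertex set of P also spans a standard ℓ-pseudo-triangle; that is, the ℓ vertices of P can be connected by a simple polygon that is a standard pseudo-triangle. -/
open Set

noncomputable section

/-- Points of the plane. -/
abbrev Pt : Type := ℝ × ℝ

/-- Two-dimensional cross product. -/
def cross2 (u w : Pt) : ℝ := u.1 * w.2 - u.2 * w.1

/-- A set of points is in general position if no three of its points are collinear. -/
def GenPos (S : Set Pt) : Prop :=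
  ∀ p ∈ S, ∀ q ∈ S, ∀ r ∈ S, p ≠ q → p ≠ r → q ≠ r →
    ¬ Collinear ℝ ({p, q, r} : Set Pt)

/-- `v : ZMod n → Pt` lists the vertices (in cyclic order) of a simple polygon:
vertices are pairwise distinct, non-adjacent edges are disjoint, and adjacent
edges meet exactly in their common vertex. -/
structure IsSimplePolygon (n : ℕ) (v : ZMod n → Pt) : Prop where
  three_le : 3 ≤ n
  inj : Function.Injective v
  nonadj : ∀ i j : ZMod n, i ≠ j → i ≠ j + 1 → j ≠ i + 1 →
    segment ℝ (v i) (v (i + 1)) ∩ segment ℝ (v j) (v (j + 1)) = ∅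
  adj : ∀ i : ZMod n,
    segment ℝ (v i) (v (i + 1)) ∩ segment ℝ (v (i + 1)) (v (i + 2)) = {v (i + 1)}

/-- Twice the signed area of a polygon. -/
def signedArea (n : ℕ) (v : ZMod n → Pt) : ℝ :=
  if h : n = 0 then 0 else
    haveI : NeZero n := ⟨h⟩
    ∑ i : ZMod n, cross2 (v i) (v (i + 1))

/-- The turning cross product at vertex `i`. -/
def vtxCross (n : ℕ) (v : ZMod n → Pt) (i : ZMod n) : ℝ :=
  cross2 (v i - v (i - 1)) (v (i + 1) - v i)

/-- Vertex `i` of a simple polygon is convex (interior angle `< π`) iff the turn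
at `i` has the same (strict) sign as the orientation of the polygon. -/
def IsConvexVtx (n : ℕ) (v : ZMod n → Pt) (i : ZMod n) : Prop :=
  0 < vtxCross n v i * signedArea n v

/-- A pseudo-triangle: a simple polygon in which every vertex is strictly convex or
strictly reflex, with exactly three convex vertices. -/
def IsPseudoTriangle (n : ℕ) (v : ZMod n → Pt) : Prop :=
  IsSimplePolygon n v ∧ (∀ i : ZMod n, vtxCross n v i ≠ 0) ∧
    {i : ZMod n | IsConvexVtx n v i}.ncard = 3

/-- A standard pseudo-triangle: each of the three side chains has at least two
edges, i.e. no two convex vertices are cyclically adjacent. -/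
def IsStandardPseudoTriangle (n : ℕ) (v : ZMod n → Pt) : Prop :=
  IsPseudoTriangle n v ∧
    ∀ i : ZMod n, IsConvexVtx n v i → ¬ IsConvexVtx n v (i + 1)

/-- A mountain: a pseudo-triangle in which exactly one side chain consists of a
single edge (i.e. exactly one cyclically adjacent pair of convex vertices);
a 3-mountain is a triangle. -/
def IsMountain (n : ℕ) (v : ZMod n → Pt) : Prop :=
  IsPseudoTriangle n v ∧
    (n = 3 ∨ {i : ZMod n | IsConvexVtx n v i ∧ IsConvexVtx n v (i + 1)}.ncard = 1)

/-- The boundary of a polygon: the union of its edges. -/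
def polyBoundary (n : ℕ) (v : ZMod n → Pt) : Set Pt :=
  ⋃ i : ZMod n, segment ℝ (v i) (v (i + 1))

/-- The interior of a simple polygon: the union of the bounded connected
components of the complement of its boundary. -/
def polyInterior (n : ℕ) (v : ZMod n → Pt) : Set Pt :=
  {x : Pt | x ∉ polyBoundary n v ∧
    Bornology.IsBounded (connectedComponentIn (polyBoundary n v)ᶜ x)}

/-- A polygon is empty in `S` if its interior contains no point of `S`. -/
def EmptyIn (n : ℕ) (v : ZMod n → Pt) (S : Set Pt) : Prop :=
  polyInterior n v ∩ S = ∅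

/-- `S` contains an empty `ℓ`-pseudo-triangle. -/
def HasEmptyPseudoTriangle (ℓ : ℕ) (S : Set Pt) : Prop :=
  ∃ v : ZMod ℓ → Pt, Set.range v ⊆ S ∧ IsPseudoTriangle ℓ v ∧ EmptyIn ℓ v S

/-- A set of points is in convex position if each of them is a vertex of their
convex hull. -/
def ConvexPos (H : Set Pt) : Prop := ∀ p ∈ H, p ∉ convexHull ℝ (H \ {p})

/-- `H` is a `k`-hole in `S`: `k` points of `S` in convex position whose convex
hull contains no other point of `S` in its interior. -/
def IsHole (k : ℕ) (S H : Set Pt) : Prop :=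
  H ⊆ S ∧ H.ncard = k ∧ ConvexPos H ∧
    ∀ p ∈ S, p ∈ interior (convexHull ℝ H) → p ∈ H

/-- `S` contains a `k`-hole. -/
def HasHole (k : ℕ) (S : Set Pt) : Prop := ∃ H : Set Pt, IsHole k S H

/-- The points of `S` that are vertices of the convex hull of `S`. -/
def hullVertices (S : Set Pt) : Set Pt := {p ∈ S | p ∉ convexHull ℝ (S \ {p})}

/-- The points of `S` lying in the interior of the convex hull of `S`. -/
def interiorPts (S : Set Pt) : Set Pt := {p ∈ S | p ∈ interior (convexHull ℝ S)}

/-- `S` is `λ`-convex: every triangle with vertices in `S` contains at most `λ`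
points of `S` in its interior. -/
def LambdaConvex (lam : ℕ) (S : Set Pt) : Prop :=
  ∀ p ∈ S, ∀ q ∈ S, ∀ r ∈ S,
    (S ∩ interior (convexHull ℝ ({p, q, r} : Set Pt))).ncard ≤ lam

section Part1
open scoped Pointwise

/-- signed angle from `u` to `w`. -/
def ang (u w : ℂ) : ℝ := Complex.arg (w / u)

lemma ang_neg (u w : ℂ) : ang (-u) (-w) = ang u w := by
  unfold ang; rw [neg_div_neg_eq]

lemma ang_sub_swap (A B C D : ℂ) : ang (A - B) (C - D) = ang (B - A) (D - C) := by
  rw [← ang_neg]; simp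

lemma exists_ang (u w : ℂ) (hu : u ≠ 0) (hw : w ≠ 0) :
    ∃ m : ℤ, ang u w = Complex.arg w - Complex.arg u + 2 * Real.pi * m := by
  have h := Complex.arg_div_coe_angle hw hu
  rw [← Real.Angle.coe_sub, Real.Angle.angle_eq_iff_two_pi_dvd_sub] at h
  obtain ⟨m, hm⟩ := h
  exact ⟨m, by unfold ang; linarith⟩

lemma ang_right (u w : ℂ) (hu : 0 < u.re) (hw : 0 < w.re) :
    ang u w = Complex.arg w - Complex.arg u := by
  obtain ⟨m, hm⟩ := exists_ang u w (by rintro rfl; simp at hu) (by rintro rfl; simp at hw)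
  have h1 := abs_lt.1 (Complex.abs_arg_lt_pi_div_two_iff.2 (Or.inl hu))
  have h2 := abs_lt.1 (Complex.abs_arg_lt_pi_div_two_iff.2 (Or.inl hw))
  have h3 := Complex.neg_pi_lt_arg (w / u)
  have h4 := Complex.arg_le_pi (w / u)
  unfold ang at *
  have hp := Real.pi_pos
  have : m = 0 := by
    have a1 : (m : ℝ) < 1 := by
      by_contra h; push Not at h; nlinarith
    have a2 : (-1 : ℝ) < m := by
      by_contra h; push Not at h; nlinarith
    have a1' : m < 1 := by exact_mod_cast a1
    have a2' : -1 < m := by exact_mod_cast a2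
    omega
  rw [hm, this]; simp

lemma ang_add (a b : ℝ) {u w z : ℂ} (hu : 0 < a * u.re + b * u.im)
    (hw : 0 < a * w.re + b * w.im) (hz : 0 < a * z.re + b * z.im) :
    ang u w + ang w z = ang u z := by
  set c : ℂ := ⟨a, -b⟩ with hc
  have hc0 : c ≠ 0 := by
    intro h
    have h1 := congrArg Complex.re h
    have h2 := congrArg Complex.im h
    simp [hc] at h1 h2
    simp [h1, h2] at hu
  have key : ∀ u w : ℂ, 0 < a * u.re + b * u.im → 0 < a * w.re + b * w.im →
      ang u w = Complex.arg (c * w) - Complex.arg (c * u) := by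
    intro u w hu hw
    rw [← ang_right (c * u) (c * w) (by simpa [hc] using hu) (by simpa [hc] using hw)]
    unfold ang
    rw [mul_div_mul_left _ _ hc0]
  rw [key u w hu hw, key w z hw hz, key u z hu hz]; ring

lemma cell {A B C D : ℂ} (h : Disjoint (segment ℝ A B) (segment ℝ C D)) :
    ang (C - A) (D - A) + ang (A - D) (B - D) = ang (A - C) (B - C) + ang (C - B) (D - B) := by
  have hcomp : ∀ x y : ℂ, IsCompact (segment ℝ x y) := fun x y => by
    rw [segment_eq_image]
    exact isCompact_Icc.image (by fun_prop)
  have h0 : Disjoint ({0} : Set ℂ) (segment ℝ C D - segment ℝ A B) := by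
    rw [Set.disjoint_left]
    rintro z rfl hz
    obtain ⟨p, hp, q, hq, hpq⟩ := Set.mem_sub.1 hz
    have : p = q := by simpa [sub_eq_zero] using hpq
    exact Set.disjoint_left.1 h hq (this ▸ hp)
  obtain ⟨f, u, v, hf1, huv, hf2⟩ := geometric_hahn_banach_compact_closed
    (convex_singleton (0 : ℂ)) isCompact_singleton
    ((convex_segment C D).sub (convex_segment A B))
    (by rw [sub_eq_add_neg]; exact ((hcomp C D).add (hcomp A B).neg).isClosed) h0
  have hu : 0 < u := by simpa using hf1 0 rfl
  have hfz : ∀ z : ℂ, f z = f 1 * z.re + f Complex.I * z.im := by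
    intro z
    have : z = (z.re : ℝ) • (1 : ℂ) + (z.im : ℝ) • Complex.I := by
      simp
    conv_lhs => rw [this]
    rw [map_add, map_smul, map_smul]; simp [mul_comm]
  have pos : ∀ p ∈ segment ℝ C D, ∀ q ∈ segment ℝ A B,
      0 < f 1 * (p - q).re + f Complex.I * (p - q).im := by
    intro p hp q hq
    rw [← hfz]
    have := hf2 (p - q) (Set.sub_mem_sub hp hq)
    linarith
  have lA := left_mem_segment ℝ A B
  have lB := right_mem_segment ℝ A B
  have lC := left_mem_segment ℝ C D
  have lD := right_mem_segment ℝ C D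
  rw [ang_sub_swap A D B D, ang_sub_swap A C B C,
    ang_add _ _ (pos _ lC _ lA) (pos _ lD _ lA) (pos _ lD _ lB),
    ang_add _ _ (pos _ lC _ lA) (pos _ lC _ lB) (pos _ lD _ lB)]

lemma im_div_sign (u w : ℂ) : (w / u).im = (u.re * w.im - u.im * w.re) / Complex.normSq u := by
  rw [Complex.div_im]; ring

/-- cross product in `ℂ`. -/
def crs (u w : ℂ) : ℝ := u.re * w.im - u.im * w.re

lemma tri {A B C : ℂ} (h : crs (B - A) (C - B) ≠ 0) :
    ang (B - A) (C - A) + ang (A - C) (B - C) = ang (B - A) (C - B) := by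
  rw [ang_sub_swap A C B C]
  set u := B - A
  set w := C - B
  have hs : C - A = u + w := by simp [u, w]
  rw [hs]
  unfold crs at h
  rcases lt_or_gt_of_ne h with h | h
  · apply ang_add (u.im - w.im) (w.re - u.re) <;> (try simp only [Complex.add_re, Complex.add_im]) <;> nlinarith
  · apply ang_add (w.im - u.im) (u.re - w.re) <;> (try simp only [Complex.add_re, Complex.add_im]) <;> nlinarith

/-- angle under which the edge `j` of the path `V` is seen from `x`. -/
def ea (V : ℕ → ℂ) (j : ℕ) (x : ℂ) : ℝ := ang (V j - x) (V (j + 1) - x)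

lemma cellsum (V : ℕ → ℂ) (A B : ℂ) (m k : ℕ)
    (h : ∀ j < k, Disjoint (segment ℝ A B) (segment ℝ (V (m + j)) (V (m + j + 1)))) :
    ∑ j ∈ Finset.range k, ea V (m + j) B - ∑ j ∈ Finset.range k, ea V (m + j) A
      = ang (A - V (m + k)) (B - V (m + k)) - ang (A - V m) (B - V m) := by
  induction k with
  | zero => simp
  | succ k ih =>
    have ih := ih (fun j hj => h j (by omega))
    have hc := cell (h k (by omega))
    rw [Finset.sum_range_succ, Finset.sum_range_succ, ← add_assoc m k 1]
    unfold ea at *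
    linarith

end Part1

section Part2
/-- A simple closed polygon with `N + 3` vertices, as a periodic sequence. -/
structure CP (N : ℕ) (V : ℕ → ℂ) : Prop where
  per : ∀ i, V (i + (N + 3)) = V i
  dis : ∀ i j, i + 2 ≤ j → j + 2 ≤ i + N + 3 →
    Disjoint (segment ℝ (V i) (V (i + 1))) (segment ℝ (V j) (V (j + 1)))
  turn : ∀ i, crs (V (i + 1) - V i) (V (i + 2) - V (i + 1)) ≠ 0
  inter : ∀ i, segment ℝ (V i) (V (i + 1)) ∩ segment ℝ (V (i + 1)) (V (i + 2)) = {V (i + 1)}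

/-- turn at vertex `i + 1`. -/
def tn (V : ℕ → ℂ) (i : ℕ) : ℝ := ang (V (i + 1) - V i) (V (i + 2) - V (i + 1))

/-- the half winding at a vertex. -/
def Hh (N : ℕ) (V : ℕ → ℂ) (i : ℕ) : ℝ := ∑ m ∈ Finset.range (N + 1), ea V (i + 1 + m) (V i)

variable {N : ℕ} {V : ℕ → ℂ}

lemma CP.tn_per (h : CP N V) (i : ℕ) : tn V (i + (N + 3)) = tn V i := by
  unfold tn
  rw [show i + (N + 3) + 1 = i + 1 + (N + 3) by ring, show i + (N + 3) + 2 = i + 2 + (N + 3) by ring,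
    h.per, h.per, h.per]

lemma CP.ea_per (h : CP N V) (i : ℕ) (x : ℂ) : ea V (i + (N + 3)) x = ea V i x := by
  unfold ea
  rw [show i + (N + 3) + 1 = i + 1 + (N + 3) by ring, h.per, h.per]

lemma CP.step (h : CP N V) (i : ℕ) : Hh N V i + tn V (i + N + 2) = Hh N V (i + 1) + tn V i := by
  have hc := cellsum V (V i) (V (i + 1)) (i + 2) N (fun j hj => h.dis _ _ (by omega) (by omega))
  have t1 := tri (h.turn i)
  have t2 := tri (h.turn (i + N + 2))
  have e1 : Hh N V i = ea V (i + 1) (V i) + ∑ j ∈ Finset.range N, ea V (i + 2 + j) (V i) := by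
    unfold Hh; rw [Finset.sum_range_succ', add_comm]
    congr 1
    exact Finset.sum_congr rfl (fun j _ => by rw [show i + 1 + (j + 1) = i + 2 + j by ring])
  have e2 : Hh N V (i + 1) = ∑ j ∈ Finset.range N, ea V (i + 2 + j) (V (i + 1))
      + ea V (i + 2 + N) (V (i + 1)) := by
    unfold Hh; rw [Finset.sum_range_succ]
  rw [e1, e2]
  unfold tn
  have p1 := h.per i
  have p2 := h.per (i + 1)
  rw [show i + 1 + (N + 3) = i + N + 2 + 2 by ring] at p2
  rw [show i + (N + 3) = i + N + 2 + 1 by ring] at p1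
  rw [p1, p2] at t2
  rw [show i + 2 + N = i + N + 2 by ring] at *
  unfold ea at *
  rw [p1, p2]
  have e3 : i + 1 + 1 = i + 2 := rfl
  rw [e3]
  linarith

lemma CP.path (h : CP N V) (k : ℕ) (hk : k ≤ N + 1) (i : ℕ) :
    ∑ j ∈ Finset.range k, ea V (i + 1 + j) (V i) + ∑ j ∈ Finset.range k, ea V (i + j) (V (i + k + 1))
      = ∑ j ∈ Finset.range k, tn V (i + j) := by
  induction k generalizing i with
  | zero => simp
  | succ k ih =>
    have ih := ih (by omega) (i + 1)
    have hc := cellsum V (V i) (V (i + 1)) (i + 2) k (fun j hj => h.dis _ _ (by omega) (by omega))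
    have t1 := tri (h.turn i)
    rw [Finset.sum_range_succ', Finset.sum_range_succ' (fun j => ea V (i + j) _),
      Finset.sum_range_succ' (fun j => tn V (i + j))]
    have c1 : ∀ j, i + 1 + (j + 1) = i + 2 + j := fun j => by ring
    have c2 : ∀ j, i + (j + 1) = i + 1 + j := fun j => by ring
    have c3 : ∀ j, i + 1 + 1 + j = i + 2 + j := fun j => by ring
    have s2 : ∀ y, ∑ j ∈ Finset.range k, ea V (i + (j + 1)) y = ∑ j ∈ Finset.range k, ea V (i + 1 + j) y :=
      fun y => Finset.sum_congr rfl (fun j _ => by rw [c2])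
    have s3 : ∑ j ∈ Finset.range k, tn V (i + (j + 1)) = ∑ j ∈ Finset.range k, tn V (i + 1 + j) :=
      Finset.sum_congr rfl (fun j _ => by rw [c2])
    rw [s2, s3, show i + (k + 1) + 1 = i + 2 + k by ring]
    simp only [c1, add_zero]
    simp only [c3] at ih
    rw [show i + 1 + k + 1 = i + 2 + k by ring] at *
    have e1 : ea V (i + 1) (V i) = ang (V (i + 1) - V i) (V (i + 2) - V i) := rfl
    have e2 : tn V i = ang (V (i + 1) - V i) (V (i + 2) - V (i + 1)) := rfl
    have e3 : ea V i (V (i + 2 + k)) = ang (V i - V (i + 2 + k)) (V (i + 1) - V (i + 2 + k)) := rfl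
    linarith

lemma CP.K_const (h : CP N V) (i : ℕ) : Hh N V i + tn V (i + N + 2) = Hh N V 0 + tn V (N + 2) := by
  induction i with
  | zero => simp
  | succ i ih =>
    rw [← ih, h.step i]
    congr 1
    rw [← h.tn_per i]; congr 1; ring

lemma CP.total (h : CP N V) :
    ∑ j ∈ Finset.range (N + 3), tn V j = 2 * (Hh N V 0 + tn V (N + 2)) := by
  have h1 := h.path (N + 1) le_rfl 0
  have h2 := h.K_const (N + 2)
  have e : Hh N V (N + 2) = ∑ j ∈ Finset.range (N + 1), ea V (0 + j) (V (0 + (N + 1) + 1)) := by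
    unfold Hh
    refine Finset.sum_congr rfl (fun j _ => ?_)
    rw [show N + 2 + 1 + j = 0 + j + (N + 3) by ring, h.ea_per]
    congr 2; ring
  rw [show N + 2 + N + 2 = N + 1 + (N + 3) by ring, h.tn_per] at h2
  rw [Finset.sum_range_succ, Finset.sum_range_succ]
  rw [← e] at h1
  unfold Hh at *
  simp only [zero_add] at *
  linarith

lemma ang_scale_left (r : ℝ) (hr : 0 < r) (u w : ℂ) : ang (r * u) w = ang u w := by
  unfold ang
  rw [show w / (r * u) = ((r⁻¹ : ℝ) : ℂ) * (w / u) by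
    push_cast; field_simp]
  exact Complex.arg_real_mul _ (by positivity)

lemma CP.atx (h : CP N V) (i : ℕ) (s : ℝ) (h0 : 0 < s) (h1 : s < 1) :
    ∑ j ∈ Finset.range (N + 2), ea V (i + 1 + j) (V i + s * (V (i + 1) - V i))
      = Hh N V 0 + tn V (N + 2) := by
  rw [← h.K_const (i + 1)]
  set x := V i + s * (V (i + 1) - V i) with hx
  have hne : V (i + 1) - V i ≠ 0 := by
    intro hz; apply h.turn i; rw [hz]; simp [crs]
  have hsub : segment ℝ x (V (i + 1)) ⊆ segment ℝ (V i) (V (i + 1)) := by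
    apply (convex_segment _ _).segment_subset _ (right_mem_segment _ _ _)
    rw [segment_eq_image']
    exact ⟨s, ⟨h0.le, h1.le⟩, by simp [hx]⟩
  have hVi : V i ∉ segment ℝ x (V (i + 1)) := by
    rw [segment_eq_image']
    rintro ⟨t, ⟨ht0, ht1⟩, ht⟩
    have : ((s + t * (1 - s) : ℝ) : ℂ) * (V (i + 1) - V i) = 0 := by
      simp only [hx, Complex.real_smul] at ht
      push_cast
      linear_combination ht
    rcases mul_eq_zero.1 this with h' | h'
    · have : s + t * (1 - s) = 0 := by exact_mod_cast h'
      nlinarith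
    · exact hne h'
  have hper1 := h.per i
  have hper2 := h.per (i + 1)
  have hc := cellsum V x (V (i + 1)) (i + 2) (N + 1) (fun j hj => by
    by_cases hj' : j < N
    · exact (h.dis i (i + 2 + j) (by omega) (by omega)).mono_left hsub
    · have : j = N := by omega
      subst this
      have hi := h.inter (i + 2 + j)
      rw [show i + 2 + j + 1 = i + (j + 3) by ring, show i + 2 + j + 2 = i + 1 + (j + 3) by ring,
        hper1, hper2] at hi
      rw [show i + 2 + j + 1 = i + (j + 3) by ring, hper1, Set.disjoint_left]
      intro z hz1 hz2
      have : z ∈ ({V i} : Set ℂ) := hi ▸ ⟨hz2, hsub hz1⟩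
      rw [Set.mem_singleton_iff] at this
      exact hVi (this ▸ hz1))
  have hxv : V (i + 1) - x = ((1 - s : ℝ) : ℂ) * (V (i + 1) - V i) := by
    simp only [hx]; push_cast; ring
  have ht : crs (V (i + 1) - x) (V (i + 2) - V (i + 1)) ≠ 0 := by
    have := h.turn i
    have h2 : crs (V (i + 1) - x) (V (i + 2) - V (i + 1))
        = (1 - s) * crs (V (i + 1) - V i) (V (i + 2) - V (i + 1)) := by
      rw [hxv]; unfold crs; rw [Complex.re_ofReal_mul, Complex.im_ofReal_mul]; ring
    rw [h2]
    exact mul_ne_zero (by linarith) this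
  have t1 := tri ht
  have t2 : ang (V (i + 1) - x) (V (i + 2) - V (i + 1)) = ang (V (i + 1) - V i) (V (i + 2) - V (i + 1)) := by
    rw [hxv, ang_scale_left _ (by linarith)]
  have z : ang (x - V i) (V (i + 1) - V i) = 0 := by
    rw [show x - V i = (s : ℂ) * (V (i + 1) - V i) by simp [hx], ang_scale_left _ h0]
    unfold ang; rw [div_self hne]; simp
  rw [show i + 2 + (N + 1) = i + (N + 3) by ring, hper1, z] at hc
  have htn : tn V (i + 1 + N + 2) = tn V i := by
    rw [← h.tn_per i]; congr 1; ring
  rw [htn]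
  rw [Finset.sum_range_succ']
  simp only [show ∀ j, i + 1 + (j + 1) = i + 2 + j from fun j => by ring, add_zero] at *
  unfold Hh
  simp only [show ∀ j, i + 1 + 1 + j = i + 2 + j from fun j => by ring] at *
  unfold tn
  have : ea V (i + 1) x = ang (V (i + 1) - x) (V (i + 2) - x) := rfl
  linarith

end Part2

section Part3
lemma alt_sum (S : Finset ℕ) (ε X : ℕ → ℝ) (k : ℝ) :
    (∀ i ∈ S, ε i = 1 ∨ ε i = -1) → (∀ i ∈ S, ∀ j ∈ S, X i = X j → i = j) →
    (∀ i ∈ S, ε i + 2 * ∑ j ∈ S with X j < X i, ε j = k) → S.Nonempty →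
    (k = 1 ∨ k = -1) ∧ ∀ t, (∀ i ∈ S, X i < t) → 0 < k * ∑ i ∈ S, ε i * (t - X i) := by
  induction S using Finset.induction_on_max_value X with
  | empty => intro _ _ _ h; simp at h
  | insert a s has hmax ih =>
    intro hε inj hk _
    have hlt : ∀ x ∈ s, X x < X a := fun x hx => lt_of_le_of_ne (hmax x hx) (fun h => by
      have := inj x (by simp [hx]) a (by simp) h
      exact has (this ▸ hx))
    have ha := hk a (by simp)
    have hf : (insert a s).filter (fun j => X j < X a) = s := by
      ext x; simp only [Finset.mem_filter, Finset.mem_insert]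
      constructor
      · rintro ⟨rfl | h, h2⟩
        · exact absurd h2 (lt_irrefl _)
        · exact h
      · intro h; exact ⟨Or.inr h, hlt x h⟩
    rw [hf] at ha
    have hea := hε a (by simp)
    rcases s.eq_empty_or_nonempty with rfl | hne
    · simp only [Finset.sum_empty, mul_zero, add_zero] at ha
      refine ⟨ha ▸ hea, fun t ht => ?_⟩
      have := ht a (by simp)
      simp only [insert_empty_eq, Finset.sum_singleton]
      rw [ha]
      rcases hea with h | h <;> rw [← ha, h] <;> linarith
    · obtain ⟨hk1, hpos⟩ := ih (fun i hi => hε i (by simp [hi]))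
        (fun i hi j hj => inj i (by simp [hi]) j (by simp [hj]))
        (fun i hi => by
          rw [← hk i (by simp [hi]), Finset.filter_insert, if_neg (not_lt.2 (hmax i hi))]) hne
      refine ⟨hk1, fun t ht => ?_⟩
      have h1 := hpos (X a) hlt
      have hta := ht a (by simp)
      rw [Finset.sum_insert has]
      have e : ∑ i ∈ s, ε i * (t - X i) = ∑ i ∈ s, ε i * (X a - X i) + (t - X a) * ∑ i ∈ s, ε i := by
        rw [Finset.mul_sum, ← Finset.sum_add_distrib]
        exact Finset.sum_congr rfl (fun i _ => by ring)
      rw [e]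
      have e2 : ∑ i ∈ s, ε i = (k - ε a) / 2 := by linarith
      rw [e2]
      have : 0 ≤ k * (k + ε a) := by
        rcases hk1 with h | h <;> rcases hea with h' | h' <;> rw [h, h'] <;> norm_num
      have h3 : 0 ≤ (t - X a) * (k * (k + ε a)) := mul_nonneg (by linarith) this
      nlinarith

lemma sum_shift (g : ℕ → ℝ) (n : ℕ) (hg : ∀ i, g (i + n) = g i) (i : ℕ) :
    ∑ j ∈ Finset.range n, g (i + j) = ∑ j ∈ Finset.range n, g j := by
  induction i with
  | zero => simp
  | succ i ih =>
    rw [← ih]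
    have h1 := Finset.sum_range_succ (fun j => g (i + j)) n
    have h2 := Finset.sum_range_succ' (fun j => g (i + j)) n
    rw [h1, hg] at h2
    simp only [add_zero] at h2
    have h3 : ∑ j ∈ Finset.range n, g (i + 1 + j) = ∑ j ∈ Finset.range n, g (i + (j + 1)) :=
      Finset.sum_congr rfl (fun j _ => by congr 1; ring)
    linarith

/-- sign of the crossing of the level `c` by the edge `u w`. -/
def eps (u w : ℂ) (c : ℝ) : ℝ :=
  if u.im < c ∧ c < w.im then 1 else if w.im < c ∧ c < u.im then -1 else 0

/-- abscissa of the crossing. -/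
def cx (u w : ℂ) (c : ℝ) : ℝ := u.re + (c - u.im) / (w.im - u.im) * (w.re - u.re)

lemma kap0 (u w : ℂ) (hu : u.im ≠ 0) (hw : w.im ≠ 0) (hc : eps u w 0 ≠ 0 → cx u w 0 ≠ 0) :
    ang u w = Complex.arg w - Complex.arg u
      - 2 * Real.pi * (if cx u w 0 < 0 then eps u w 0 else 0) := by
  have hu0 : u ≠ 0 := by rintro rfl; simp at hu
  have hw0 : w ≠ 0 := by rintro rfl; simp at hw
  obtain ⟨m, hm⟩ := exists_ang u w hu0 hw0
  have hp := Real.pi_pos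
  have range : ∀ z : ℂ, z.im ≠ 0 → (0 < z.im ∧ 0 < Complex.arg z ∧ Complex.arg z < Real.pi) ∨
      (z.im < 0 ∧ -Real.pi < Complex.arg z ∧ Complex.arg z < 0) := by
    intro z hz
    rcases lt_or_gt_of_ne hz with h | h
    · exact Or.inr ⟨h, Complex.neg_pi_lt_arg z, Complex.arg_neg_iff.2 h⟩
    · refine Or.inl ⟨h, ?_, Complex.arg_lt_pi_iff.2 (Or.inr hz)⟩
      refine lt_of_le_of_ne (Complex.arg_nonneg_iff.2 h.le) (fun h' => ?_)
      have := Complex.arg_eq_zero_iff.1 h'.symm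
      exact hz this.2
  have r1 := range u hu
  have r2 := range w hw
  have hns : 0 < Complex.normSq u := Complex.normSq_pos.2 hu0
  have hm_eq : ∀ q : ℤ, (-1 : ℝ) < m - q → (m : ℝ) - q < 1 → m = q := by
    intro q h1 h2
    have h1' : -1 < m - q := by exact_mod_cast h1
    have h2' : m - q < 1 := by exact_mod_cast h2
    omega
  have b1 : -Real.pi < ang u w := Complex.neg_pi_lt_arg _
  have b2 : ang u w ≤ Real.pi := Complex.arg_le_pi _
  have cxe : w.im - u.im ≠ 0 → cx u w 0 * (w.im - u.im) = u.re * w.im - u.im * w.re := by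
    intro h; unfold cx; field_simp; ring
  have angpos : 0 < u.re * w.im - u.im * w.re → 0 < ang u w := by
    intro h
    have : 0 < (w / u).im := by rw [im_div_sign]; positivity
    rcases range _ this.ne' with h | h
    · exact h.2.1
    · linarith [h.1]
  have angneg : u.re * w.im - u.im * w.re < 0 → ang u w < 0 := by
    intro h
    have : (w / u).im < 0 := by rw [im_div_sign]; exact div_neg_of_neg_of_pos h hns
    exact Complex.arg_neg_iff.2 this
  rcases r1 with ⟨i1, a1, a2⟩ | ⟨i1, a1, a2⟩ <;> rcases r2 with ⟨i2, a3, a4⟩ | ⟨i2, a3, a4⟩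
  · have he : eps u w 0 = 0 := by
      unfold eps; rw [if_neg (by intro h; linarith [h.1]), if_neg (by intro h; linarith [h.1])]
    have : m = 0 := hm_eq 0 (by push_cast; by_contra h; push Not at h; nlinarith) (by push_cast; by_contra h; push Not at h; nlinarith)
    rw [hm, he, this]; simp
  · have he : eps u w 0 = -1 := by
      unfold eps; rw [if_neg (by intro h; linarith [h.1]), if_pos ⟨i2, i1⟩]
    have hx := hc (by rw [he]; norm_num)
    have hcx := cxe (by linarith)
    rcases lt_or_gt_of_ne hx with hx | hx
    · have := angpos (by rw [← hcx]; nlinarith)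
      have : m = 1 := hm_eq 1 (by push_cast; by_contra h; push Not at h; nlinarith) (by push_cast; by_contra h; push Not at h; nlinarith)
      rw [hm, he, this, if_pos hx]; push_cast; ring
    · have := angneg (by rw [← hcx]; nlinarith)
      have : m = 0 := hm_eq 0 (by push_cast; by_contra h; push Not at h; nlinarith) (by push_cast; by_contra h; push Not at h; nlinarith)
      rw [hm, he, this, if_neg hx.le.not_gt]; push_cast; ring
  · have he : eps u w 0 = 1 := by
      unfold eps; rw [if_pos ⟨i1, i2⟩]
    have hx := hc (by rw [he]; norm_num)
    have hcx := cxe (by linarith)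
    rcases lt_or_gt_of_ne hx with hx | hx
    · have := angneg (by rw [← hcx]; nlinarith)
      have : m = -1 := hm_eq (-1) (by push_cast; by_contra h; push Not at h; nlinarith) (by push_cast; by_contra h; push Not at h; nlinarith)
      rw [hm, he, this, if_pos hx]; push_cast; ring
    · have := angpos (by rw [← hcx]; nlinarith)
      have : m = 0 := hm_eq 0 (by push_cast; by_contra h; push Not at h; nlinarith) (by push_cast; by_contra h; push Not at h; nlinarith)
      rw [hm, he, this, if_neg hx.le.not_gt]; push_cast; ring
  · have he : eps u w 0 = 0 := by
      unfold eps; rw [if_neg (by intro h; linarith [h.2]), if_neg (by intro h; linarith [h.2])]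
    have : m = 0 := hm_eq 0 (by push_cast; by_contra h; push Not at h; nlinarith) (by push_cast; by_contra h; push Not at h; nlinarith)
    rw [hm, he, this]; simp

lemma kap (u w x : ℂ) (hu : u.im ≠ x.im) (hw : w.im ≠ x.im)
    (hc : eps u w x.im ≠ 0 → cx u w x.im ≠ x.re) :
    ang (u - x) (w - x) = Complex.arg (w - x) - Complex.arg (u - x)
      - 2 * Real.pi * (if cx u w x.im < x.re then eps u w x.im else 0) := by
  have e1 : eps (u - x) (w - x) 0 = eps u w x.im := by
    unfold eps; simp
  have e2 : cx (u - x) (w - x) 0 = cx u w x.im - x.re := by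
    unfold cx; simp; ring
  have := kap0 (u - x) (w - x) (by simpa [sub_eq_zero] using hu) (by simpa [sub_eq_zero] using hw)
    (by rw [e1, e2, sub_ne_zero]; exact hc)
  rw [this, e1, e2]
  simp [sub_neg]

end Part3

section Part4
variable {N : ℕ} {V : ℕ → ℂ}

/-- level crossing sign of edge `j`. -/
def ep (V : ℕ → ℂ) (c : ℝ) (j : ℕ) : ℝ := eps (V j) (V (j + 1)) c
/-- crossing abscissa of edge `j`. -/
def xx (V : ℕ → ℂ) (c : ℝ) (j : ℕ) : ℝ := cx (V j) (V (j + 1)) c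
/-- the constant half winding. -/
def KK (N : ℕ) (V : ℕ → ℂ) : ℝ := Hh N V 0 + tn V (N + 2)

lemma eps_ne {u w : ℂ} {c : ℝ} (h : eps u w c ≠ 0) :
    (eps u w c = 1 ∧ u.im < c ∧ c < w.im) ∨ (eps u w c = -1 ∧ w.im < c ∧ c < u.im) := by
  unfold eps at *
  split_ifs at * with h1 h2
  · exact Or.inl ⟨rfl, h1⟩
  · exact Or.inr ⟨rfl, h2⟩
  · exact absurd rfl h

lemma cross_pt {u w : ℂ} {c : ℝ} (h : eps u w c ≠ 0) :
    ∃ s : ℝ, 0 < s ∧ s < 1 ∧ u + s * (w - u) = ⟨cx u w c, c⟩ := by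
  have hne : w.im - u.im ≠ 0 := by
    rcases eps_ne h with h | h <;> [skip; skip] <;> intro h' <;> linarith [h.2.1, h.2.2]
  refine ⟨(c - u.im) / (w.im - u.im), ?_, ?_, ?_⟩
  · rcases eps_ne h with ⟨_, h1, h2⟩ | ⟨_, h1, h2⟩
    · apply div_pos <;> linarith
    · apply div_pos_of_neg_of_neg <;> linarith
  · rcases eps_ne h with ⟨_, h1, h2⟩ | ⟨_, h1, h2⟩
    · rw [div_lt_one (by linarith)]; linarith
    · rw [div_lt_one_of_neg (by linarith)]; linarith
  · apply Complex.ext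
    · simp only [Complex.add_re, Complex.re_ofReal_mul, Complex.sub_re, cx]
    · simp only [Complex.add_im, Complex.im_ofReal_mul, Complex.sub_im]
      field_simp; ring

lemma mem_seg_of {u w z : ℂ} (s : ℝ) (h0 : 0 < s) (h1 : s < 1) (h : u + s * (w - u) = z) :
    z ∈ segment ℝ u w := by
  rw [segment_eq_image']
  exact ⟨s, ⟨h0.le, h1.le⟩, by simpa using h⟩

lemma CP.xx_ne (h : CP N V) (c : ℝ) (hc : ∀ i, (V i).im ≠ c) (i m : ℕ) (hm : 1 ≤ m) (hm2 : m ≤ N + 2)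
    (h1 : ep V c i ≠ 0) (h2 : ep V c (i + m) ≠ 0) : xx V c (i + m) ≠ xx V c i := by
  intro he
  obtain ⟨s, s0, s1, hs⟩ := cross_pt h1
  obtain ⟨t, t0, t1, ht⟩ := cross_pt h2
  have a1 := mem_seg_of s s0 s1 hs
  have a2 := mem_seg_of t t0 t1 ht
  unfold xx at he
  rw [he] at a2
  by_cases hm1 : m = 1
  · subst hm1
    have : (⟨cx (V i) (V (i + 1)) c, c⟩ : ℂ) ∈ ({V (i + 1)} : Set ℂ) := h.inter i ▸ ⟨a1, a2⟩
    apply hc (i + 1)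
    rw [← Set.mem_singleton_iff.1 this]
  · by_cases hm3 : m = N + 2
    · subst hm3
      have hi := h.inter (i + (N + 2))
      have e1 : V (i + (N + 2) + 1) = V i := h.per i
      have e2 : V (i + (N + 2) + 2) = V (i + 1) := by rw [← h.per (i + 1)]; congr 1; ring
      rw [e1, e2] at hi
      rw [e1] at a2
      have : (⟨cx (V i) (V (i + 1)) c, c⟩ : ℂ) ∈ ({V i} : Set ℂ) := hi ▸ ⟨a2, a1⟩
      apply hc i
      rw [← Set.mem_singleton_iff.1 this]
    · exact Set.disjoint_left.1 (h.dis i (i + m) (by omega) (by omega)) a1 a2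

lemma CP.level (h : CP N V) (c : ℝ) (hc : ∀ i, (V i).im ≠ c) (i : ℕ) (hi : ep V c i ≠ 0) :
    ep V c i + 2 * ∑ j ∈ Finset.range (N + 3), (if xx V c j < xx V c i then ep V c j else 0)
      = - KK N V / Real.pi := by
  obtain ⟨s, s0, s1, hs⟩ := cross_pt hi
  have hK := h.atx i s s0 s1
  rw [hs] at hK
  set x : ℂ := ⟨cx (V i) (V (i + 1)) c, c⟩ with hx
  have hxim : x.im = c := rfl
  have hxre : x.re = xx V c i := rfl
  set g : ℕ → ℝ := fun j => if xx V c j < xx V c i then ep V c j else 0 with hg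
  have hgper : ∀ j, g (j + (N + 3)) = g j := by
    intro j
    have q1 : xx V c (j + (N + 3)) = xx V c j := by
      unfold xx; rw [show j + (N + 3) + 1 = j + 1 + (N + 3) by ring, h.per, h.per]
    have q2 : ep V c (j + (N + 3)) = ep V c j := by
      unfold ep; rw [show j + (N + 3) + 1 = j + 1 + (N + 3) by ring, h.per, h.per]
    simp only [hg, q1, q2]
  have e1 : ∀ j ∈ Finset.range (N + 2), ea V (i + 1 + j) x =
      (Complex.arg (V (i + 1 + (j + 1)) - x) - Complex.arg (V (i + 1 + j) - x))
        - 2 * Real.pi * g (i + (j + 1)) := by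
    intro j hj
    rw [Finset.mem_range] at hj
    unfold ea
    rw [kap (V (i + 1 + j)) (V (i + 1 + j + 1)) x (hc _) (hc _) (fun h' => by
      have := h.xx_ne c hc i (j + 1) (by omega) (by omega) hi
        (by rw [show i + (j + 1) = i + 1 + j by ring]; exact h')
      rw [show i + (j + 1) = i + 1 + j by ring] at this
      exact this)]
    rw [show i + (j + 1) = i + 1 + j by ring]
    rfl
  rw [Finset.sum_congr rfl e1, Finset.sum_sub_distrib,
    Finset.sum_range_sub (fun j => Complex.arg (V (i + 1 + j) - x)), ← Finset.mul_sum] at hK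
  have hs1 := sum_shift g (N + 3) hgper i
  rw [Finset.sum_range_succ'] at hs1
  have g0 : g (i + 0) = 0 := by simp [hg]
  rw [g0, add_zero] at hs1
  rw [hs1, show i + 1 + (N + 2) = i + (N + 3) by ring, h.per, add_zero] at hK
  have d1 : V i - x = ((s : ℝ) : ℂ) * (-(V (i + 1) - V i)) := by rw [← hs]; ring
  have d2 : V (i + 1) - x = ((1 - s : ℝ) : ℂ) * (V (i + 1) - V i) := by rw [← hs]; push_cast; ring
  rw [d1, d2, Complex.arg_real_mul _ s0, Complex.arg_real_mul _ (by linarith)] at hK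
  have hp := Real.pi_pos
  have harg : Complex.arg (-(V (i + 1) - V i)) - Complex.arg (V (i + 1) - V i) = - Real.pi * ep V c i := by
    rcases eps_ne hi with ⟨h1, h2, h3⟩ | ⟨h1, h2, h3⟩
    · rw [Complex.arg_neg_eq_arg_sub_pi_of_im_pos (by simp; linarith)]
      unfold ep; rw [h1]; ring
    · rw [Complex.arg_neg_eq_arg_add_pi_of_im_neg (by simp; linarith)]
      unfold ep; rw [h1]; ring
  rw [harg] at hK
  unfold KK
  rw [← hK]
  field_simp
  ring

lemma ep_sum (h : CP N V) (c : ℝ) (hc : ∀ i, (V i).im ≠ c) :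
    ∑ j ∈ Finset.range (N + 3), ep V c j = 0 := by
  have : ∀ j ∈ Finset.range (N + 3), ep V c j =
      (if c < (V (j + 1)).im then (1 : ℝ) else 0) - (if c < (V j).im then (1 : ℝ) else 0) := by
    intro j _
    unfold ep eps
    rcases lt_or_gt_of_ne (hc j) with h1 | h1 <;> rcases lt_or_gt_of_ne (hc (j + 1)) with h2 | h2 <;>
      simp [h1, h2, h1.not_gt, h2.not_gt]
  rw [Finset.sum_congr rfl this, Finset.sum_range_sub (fun j => if c < (V j).im then (1 : ℝ) else 0)]
  have := h.per 0
  rw [zero_add] at this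
  rw [this]; simp

lemma CP.level_sum (h : CP N V) (c : ℝ) (hc : ∀ i, (V i).im ≠ c) (i : ℕ) (hi : i < N + 3)
    (hi0 : ep V c i ≠ 0) :
    (KK N V = Real.pi ∨ KK N V = - Real.pi) ∧
      0 < KK N V * ∑ j ∈ Finset.range (N + 3), ep V c j * xx V c j := by
  set S := (Finset.range (N + 3)).filter (fun j => ep V c j ≠ 0) with hS
  have hp := Real.pi_pos
  obtain ⟨h1, h2⟩ := alt_sum S (ep V c) (xx V c) (- KK N V / Real.pi)
    (fun i hi => by
      rcases eps_ne (Finset.mem_filter.1 hi).2 with h | h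
      · exact Or.inl h.1
      · exact Or.inr h.1)
    (fun i hi j hj he => by
      obtain ⟨a1, a2⟩ := Finset.mem_filter.1 hi
      obtain ⟨b1, b2⟩ := Finset.mem_filter.1 hj
      rw [Finset.mem_range] at a1 b1
      rcases lt_trichotomy i j with hl | hl | hl
      · exact absurd (by rw [show i + (j - i) = j by omega]; exact he.symm)
          (h.xx_ne c hc i (j - i) (by omega) (by omega) a2 (by rwa [show i + (j - i) = j by omega]))
      · exact hl
      · exact absurd (by rw [show j + (i - j) = i by omega]; exact he)
          (h.xx_ne c hc j (i - j) (by omega) (by omega) b2 (by rwa [show j + (i - j) = i by omega])))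
    (fun i hi => by
      rw [← h.level c hc i (Finset.mem_filter.1 hi).2]
      congr 2
      rw [Finset.sum_filter, hS, Finset.sum_filter]
      refine Finset.sum_congr rfl (fun j _ => ?_)
      by_cases hz : ep V c j = 0 <;> simp [hz])
    ⟨i, Finset.mem_filter.2 ⟨Finset.mem_range.2 hi, hi0⟩⟩
  refine ⟨?_, ?_⟩
  · rcases h1 with h1 | h1
    · right; field_simp at h1; linarith
    · left; field_simp at h1; linarith
  · obtain ⟨t, ht⟩ : ∃ t, ∀ i ∈ S, xx V c i < t := by
      refine ⟨∑ i ∈ S, |xx V c i| + 1, fun i hi => ?_⟩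
      have := Finset.single_le_sum (f := fun i => |xx V c i|) (fun i _ => abs_nonneg _) hi
      have h3 := le_abs_self (xx V c i)
      linarith
    have h3 := h2 t ht
    have e1 : ∑ i ∈ S, ep V c i * (t - xx V c i) = ∑ j ∈ Finset.range (N + 3), ep V c j * (t - xx V c j) := by
      rw [hS, Finset.sum_filter]
      refine Finset.sum_congr rfl (fun j _ => ?_)
      by_cases hz : ep V c j = 0 <;> simp [hz]
    have e2 : ∑ j ∈ Finset.range (N + 3), ep V c j * (t - xx V c j)
        = t * ∑ j ∈ Finset.range (N + 3), ep V c j - ∑ j ∈ Finset.range (N + 3), ep V c j * xx V c j := by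
      rw [Finset.mul_sum, ← Finset.sum_sub_distrib]
      exact Finset.sum_congr rfl (fun i _ => by ring)
    rw [e1, e2, ep_sum h c hc] at h3
    have e3 : KK N V * ∑ j ∈ Finset.range (N + 3), ep V c j * xx V c j
        = Real.pi * (-KK N V / Real.pi * (t * 0 - ∑ j ∈ Finset.range (N + 3), ep V c j * xx V c j)) := by
      field_simp; ring
    rw [e3]; positivity

end Part4

section Part5
variable {N : ℕ} {V : ℕ → ℂ}

lemma edge_int0 (u w : ℂ) (h : u.im < w.im) :
    MeasureTheory.Integrable (fun c => eps u w c * cx u w c) ∧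
      ∫ c, eps u w c * cx u w c = (u.re + w.re) / 2 * (w.im - u.im) := by
  have e : (fun c => eps u w c * cx u w c) = (Ioo u.im w.im).indicator (fun c => cx u w c) := by
    funext c
    unfold eps
    by_cases hc : u.im < c ∧ c < w.im
    · rw [if_pos hc, Set.indicator_of_mem (show c ∈ Ioo _ _ from hc), one_mul]
    · rw [if_neg hc, Set.indicator_of_notMem (show c ∉ Ioo _ _ from hc),
        if_neg (fun h' => by linarith [h'.1, h'.2]), zero_mul]
  have hcont : Continuous (fun c => cx u w c) := by unfold cx; fun_prop
  rw [e]
  refine ⟨?_, ?_⟩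
  · rw [MeasureTheory.integrable_indicator_iff measurableSet_Ioo]
    exact (hcont.integrableOn_Icc (a := u.im) (b := w.im)).mono_set Ioo_subset_Icc_self
  · rw [MeasureTheory.integral_indicator measurableSet_Ioo, ← MeasureTheory.integral_Ioc_eq_integral_Ioo,
      ← intervalIntegral.integral_of_le h.le]
    have hne : w.im - u.im ≠ 0 := by linarith
    have : (fun c => cx u w c) = fun c => (u.re - u.im / (w.im - u.im) * (w.re - u.re)) +
        ((w.re - u.re) / (w.im - u.im)) * c := by
      funext c; unfold cx; field_simp; ring
    rw [this, intervalIntegral.integral_add (Continuous.intervalIntegrable (by fun_prop) _ _) (by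
      exact (Continuous.intervalIntegrable (by fun_prop) _ _)), intervalIntegral.integral_const,
      intervalIntegral.integral_const_mul, integral_id, smul_eq_mul]
    field_simp; ring

lemma edge_int (u w : ℂ) :
    MeasureTheory.Integrable (fun c => eps u w c * cx u w c) ∧
      ∫ c, eps u w c * cx u w c = (u.re + w.re) / 2 * (w.im - u.im) := by
  rcases lt_trichotomy u.im w.im with h | h | h
  · exact edge_int0 u w h
  · have : (fun c => eps u w c * cx u w c) = fun _ => 0 := by
      funext c; unfold eps
      rw [if_neg (fun h' => by linarith [h'.1, h'.2]), if_neg (fun h' => by linarith [h'.1, h'.2]), zero_mul]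
    rw [this]; simp [h]
  · have e : (fun c => eps u w c * cx u w c) = fun c => - (eps w u c * cx w u c) := by
      funext c
      have hne : w.im - u.im ≠ 0 := by linarith
      have hne' : u.im - w.im ≠ 0 := by linarith
      have h1 : cx u w c = cx w u c := by unfold cx; field_simp; ring
      have h2 : eps u w c = - eps w u c := by
        unfold eps
        by_cases hc : w.im < c ∧ c < u.im
        · rw [if_neg (fun h' => by linarith [h'.1, h'.2]), if_pos hc, if_pos hc]
        · rw [if_neg (fun h' => by linarith [h'.1, h'.2]), if_neg hc, if_neg hc,
            if_neg (fun h' => by linarith [h'.1, h'.2])]; simp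
      rw [h1, h2]; ring
    obtain ⟨h1, h2⟩ := edge_int0 w u h
    rw [e]
    refine ⟨h1.neg, ?_⟩
    rw [MeasureTheory.integral_neg, h2]; ring

/-- the (doubled) area. -/
def AA (N : ℕ) (V : ℕ → ℂ) : ℝ := ∑ j ∈ Finset.range (N + 3), crs (V j) (V (j + 1))

lemma area_int (h : CP N V) :
    MeasureTheory.Integrable (fun c => ∑ j ∈ Finset.range (N + 3), ep V c j * xx V c j) ∧
      2 * ∫ c, ∑ j ∈ Finset.range (N + 3), ep V c j * xx V c j = AA N V := by
  refine ⟨MeasureTheory.integrable_finsetSum _ (fun j _ => (edge_int (V j) (V (j + 1))).1), ?_⟩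
  simp only [ep, xx]
  rw [MeasureTheory.integral_finsetSum _ (fun j _ => (edge_int (V j) (V (j + 1))).1)]
  rw [Finset.sum_congr rfl (fun j _ => (edge_int (V j) (V (j + 1))).2)]
  rw [Finset.mul_sum]
  have e : ∀ j ∈ Finset.range (N + 3), 2 * (((V j).re + (V (j + 1)).re) / 2 * ((V (j + 1)).im - (V j).im))
      = crs (V j) (V (j + 1)) + ((V (j + 1)).re * (V (j + 1)).im - (V j).re * (V j).im) := by
    intro j _; unfold crs; ring
  rw [Finset.sum_congr rfl e, Finset.sum_add_distrib,
    Finset.sum_range_sub (fun j => (V j).re * (V j).im)]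
  have := h.per 0
  rw [zero_add] at this
  rw [this]; unfold AA; ring

lemma CP.area (h : CP N V) :
    (KK N V = Real.pi ∧ 0 < AA N V) ∨ (KK N V = - Real.pi ∧ AA N V < 0) := by
  obtain ⟨hI, hA⟩ := area_int h
  set F : ℝ → ℝ := fun c => ∑ j ∈ Finset.range (N + 3), ep V c j * xx V c j with hF
  set B : Set ℝ := ↑((Finset.range (N + 3)).image (fun i => (V i).im)) with hB
  have hBfin : B.Finite := Finset.finite_toSet _
  have hVmod : ∀ i, V i = V (i % (N + 3)) := by
    intro i
    have : ∀ k m, V (m + (N + 3) * k) = V m := by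
      intro k m
      induction k with
      | zero => simp
      | succ k ih => rw [show m + (N + 3) * (k + 1) = m + (N + 3) * k + (N + 3) by ring, h.per, ih]
    conv_lhs => rw [← Nat.mod_add_div i (N + 3)]
    exact this _ _
  have hBc : ∀ c, c ∉ B → ∀ i, (V i).im ≠ c := by
    intro c hc i he
    apply hc
    rw [hB, Finset.mem_coe, Finset.mem_image]
    exact ⟨i % (N + 3), Finset.mem_range.2 (Nat.mod_lt _ (by omega)), by rw [← hVmod, he]⟩
  obtain ⟨j, hj, hjne⟩ : ∃ j, j < N + 3 ∧ (V j).im ≠ (V (j + 1)).im := by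
    by_contra hcon
    push Not at hcon
    apply h.turn 0
    have h0 := hcon 0 (by omega)
    have h1 := hcon 1 (by omega)
    simp only [zero_add] at *
    unfold crs
    simp only [Complex.sub_im]
    rw [h0, h1]; ring
  have hep : ∀ c, c ∈ uIoo (V j).im (V (j + 1)).im → ep V c j ≠ 0 := by
    intro c hc
    unfold ep eps
    rcases lt_or_gt_of_ne hjne with hl | hl
    · rw [uIoo_of_lt hl] at hc
      rw [if_pos ⟨hc.1, hc.2⟩]; norm_num
    · rw [uIoo_of_gt hl] at hc
      rw [if_neg (fun h' => by linarith [h'.1, h'.2]), if_pos ⟨hc.1, hc.2⟩]; norm_num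
  have hinf : (uIoo (V j).im (V (j + 1)).im).Infinite := by
    rcases lt_or_gt_of_ne hjne with hl | hl
    · rw [uIoo_of_lt hl]; exact Ioo_infinite hl
    · rw [uIoo_of_gt hl]; exact Ioo_infinite hl
  obtain ⟨c0, hc0, hc0B⟩ := (hinf.sdiff hBfin).nonempty
  have hK := (h.level_sum c0 (hBc c0 hc0B) j hj (hep c0 hc0)).1
  have hnn : ∀ c, c ∉ B → 0 ≤ KK N V * F c := by
    intro c hc
    by_cases hz : ∃ i, i < N + 3 ∧ ep V c i ≠ 0
    · obtain ⟨i, hi, hi0⟩ := hz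
      exact (h.level_sum c (hBc c hc) i hi hi0).2.le
    · push Not at hz
      have : F c = 0 := Finset.sum_eq_zero (fun i hi => by rw [hz i (Finset.mem_range.1 hi), zero_mul])
      rw [this, mul_zero]
  have hpos : 0 < ∫ c, KK N V * F c := by
    rw [MeasureTheory.integral_pos_iff_support_of_nonneg_ae]
    · have hsub : uIoo (V j).im (V (j + 1)).im \ B ⊆ Function.support (fun c => KK N V * F c) := by
        intro c hc
        exact (h.level_sum c (hBc c hc.2) j hj (hep c hc.1)).2.ne'
      refine lt_of_lt_of_le ?_ (MeasureTheory.measure_mono hsub)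
      rw [MeasureTheory.measure_sdiff_null (hBfin.measure_zero _)]
      rcases lt_or_gt_of_ne hjne with hl | hl
      · rw [uIoo_of_lt hl]; simpa using hl
      · rw [uIoo_of_gt hl]; simpa using hl
    · have : ∀ᵐ c : ℝ, c ∉ B := MeasureTheory.measure_eq_zero_iff_ae_notMem.1 (hBfin.measure_zero _)
      filter_upwards [this] with c hc
      exact hnn c hc
    · exact hI.const_mul _
  rw [MeasureTheory.integral_const_mul] at hpos
  have hp := Real.pi_pos
  rcases hK with hK | hK
  · left; refine ⟨hK, ?_⟩
    rw [hK] at hpos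
    have := (mul_pos_iff_of_pos_left hp).1 hpos
    linarith
  · right; refine ⟨hK, ?_⟩
    rw [hK] at hpos
    have : ∫ c, F c < 0 := by
      by_contra hcon
      push Not at hcon
      nlinarith
    linarith

end Part5

section Part6
variable {N : ℕ} {V : ℕ → ℂ}

/-- edge vector. -/
def dd (V : ℕ → ℂ) (j : ℕ) : ℂ := V (j + 1) - V j

/-- half of the combinatorial pseudo-triangle conditions. -/
structure HP (d : ℕ → ℂ) (k p q : ℕ) : Prop where
  neg : ∀ i j, i < j → j < p → crs (d (k + i)) (d (k + j)) < 0
  pos : ∀ i j, i < p → j < q → 0 < crs (d (k + i)) (d (k + p + j))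

lemma CP.dd_ne (h : CP N V) (j : ℕ) : dd V j ≠ 0 := by
  intro h0
  apply h.turn j
  unfold dd at h0
  rw [h0]; simp [crs]

lemma CP.dd_rot (h : CP N V) (i m : ℕ) : ∃ R : ℝ, 0 < R ∧
    dd V (i + m) = R * Complex.exp ((∑ t ∈ Finset.range m, tn V (i + t) : ℝ) * Complex.I) * dd V i := by
  induction m with
  | zero => exact ⟨1, one_pos, by simp⟩
  | succ m ih =>
    obtain ⟨R, hR, e⟩ := ih
    have h0 := h.dd_ne (i + m)
    have h1 := h.dd_ne (i + m + 1)
    refine ⟨‖dd V (i + m + 1) / dd V (i + m)‖ * R, mul_pos (norm_pos_iff.2 (div_ne_zero h1 h0)) hR, ?_⟩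
    have h2 := Complex.norm_mul_exp_arg_mul_I (dd V (i + m + 1) / dd V (i + m))
    have h3 : Complex.arg (dd V (i + m + 1) / dd V (i + m)) = tn V (i + m) := rfl
    rw [h3] at h2
    have h4 : dd V (i + (m + 1)) = dd V (i + m + 1) / dd V (i + m) * dd V (i + m) := by
      field_simp; rfl
    rw [h4, Finset.sum_range_succ]
    generalize dd V (i + m + 1) / dd V (i + m) = z at h2
    rw [← h2, norm_mul, Complex.norm_exp_ofReal_mul_I]
    simp only [Complex.norm_real, norm_norm]
    rw [e]
    push_cast
    rw [add_mul, Complex.exp_add]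
    ring

lemma CP.crs_sin (h : CP N V) (i m : ℕ) : ∃ R : ℝ, 0 < R ∧
    crs (dd V i) (dd V (i + m)) = R * Real.sin (∑ t ∈ Finset.range m, tn V (i + t)) := by
  obtain ⟨R, hR, e⟩ := h.dd_rot i m
  refine ⟨R * Complex.normSq (dd V i), mul_pos hR (Complex.normSq_pos.2 (h.dd_ne i)), ?_⟩
  rw [e, Complex.exp_mul_I]
  rw [← Complex.ofReal_cos, ← Complex.ofReal_sin]
  simp only [crs, Complex.mul_re, Complex.mul_im, Complex.add_re, Complex.add_im, Complex.ofReal_re,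
    Complex.ofReal_im, Complex.I_re, Complex.I_im, Complex.normSq_apply]
  ring

lemma CP.tn_lt (h : CP N V) (i : ℕ) : tn V i < Real.pi ∧ -Real.pi < tn V i := by
  refine ⟨lt_of_le_of_ne (Complex.arg_le_pi _) ?_, Complex.neg_pi_lt_arg _⟩
  intro he
  obtain ⟨R, hR, e⟩ := h.crs_sin i 1
  simp only [Finset.range_one, Finset.sum_singleton, add_zero] at e
  rw [he, Real.sin_pi, mul_zero] at e
  exact h.turn i e

lemma CP.tn_pos (h : CP N V) (i : ℕ) : 0 < tn V i ↔ 0 < crs (dd V i) (dd V (i + 1)) := by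
  obtain ⟨R, hR, e⟩ := h.crs_sin i 1
  simp only [Finset.range_one, Finset.sum_singleton, add_zero] at e
  obtain ⟨h1, h2⟩ := h.tn_lt i
  rw [e, mul_pos_iff_of_pos_left hR]
  constructor
  · intro h3; exact Real.sin_pos_of_pos_of_lt_pi h3 h1
  · intro h3
    by_contra h4
    push Not at h4
    linarith [Real.sin_nonpos_of_nonpos_of_neg_pi_le h4 h2.le]

/-- indicator of corners. -/
def cn (V : ℕ → ℂ) (i : ℕ) : ℝ := if 0 < tn V i then Real.pi else 0

lemma CP.tn_ne (h : CP N V) (i : ℕ) : tn V i ≠ 0 := by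
  intro he
  obtain ⟨R, hR, e⟩ := h.crs_sin i 1
  simp only [Finset.range_one, Finset.sum_singleton, add_zero] at e
  rw [he, Real.sin_zero, mul_zero] at e
  exact h.turn i e

lemma CP.tn_cn (h : CP N V) (i : ℕ) : tn V i < cn V i := by
  unfold cn
  split_ifs with h1
  · exact (h.tn_lt i).1
  · exact lt_of_le_of_ne (not_lt.1 h1) (h.tn_ne i)

lemma CP.window (h : CP N V) (hA : 0 < AA N V)
    (h3 : ∑ j ∈ Finset.range (N + 3), cn V j = 3 * Real.pi) (i m : ℕ) (hm : 1 ≤ m) (hm2 : m < N + 3) :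
    (∑ t ∈ Finset.range m, tn V (i + t)) < ∑ t ∈ Finset.range m, cn V (i + t) ∧
    ∑ t ∈ Finset.range m, cn V (i + t) - Real.pi < (∑ t ∈ Finset.range m, tn V (i + t)) := by
  have hp := Real.pi_pos
  have hK : KK N V = Real.pi := by
    rcases h.area with h' | h'
    · exact h'.1
    · linarith [h'.2]
  have hT := h.total
  change _ = 2 * KK N V at hT
  rw [hK] at hT
  have hcper : ∀ i, cn V (i + (N + 3)) = cn V i := fun i => by unfold cn; rw [h.tn_per]
  have s1 := sum_shift (tn V) (N + 3) h.tn_per i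
  have s2 := sum_shift (cn V) (N + 3) hcper i
  obtain ⟨l, hl⟩ : ∃ l, N + 3 = m + l := ⟨N + 3 - m, by omega⟩
  rw [hT, hl, Finset.sum_range_add] at s1
  rw [h3, hl, Finset.sum_range_add] at s2
  have w1 : ∀ m i, 1 ≤ m → (∑ t ∈ Finset.range m, tn V (i + t)) < ∑ t ∈ Finset.range m, cn V (i + t) :=
    fun m i hm => Finset.sum_lt_sum_of_nonempty ⟨0, Finset.mem_range.2 (by omega)⟩ (fun t _ => h.tn_cn _)
  refine ⟨w1 m i hm, ?_⟩
  have := w1 l (i + m) (by omega)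
  simp only [add_assoc] at this s1 s2
  linarith

lemma CP.half (h : CP N V) (hA : 0 < AA N V)
    (h3 : ∑ j ∈ Finset.range (N + 3), cn V j = 3 * Real.pi) (k p q : ℕ) (hpq : p + q ≤ N + 3)
    (hc : ∀ t, t + 1 < p + q → (0 < tn V (k + t) ↔ t + 1 = p)) : HP (dd V) k p q := by
  have hp := Real.pi_pos
  constructor
  · intro i j hij hj
    obtain ⟨R, hR, e⟩ := h.crs_sin (k + i) (j - i)
    obtain ⟨w1, w2⟩ := h.window hA h3 (k + i) (j - i) (by omega) (by omega)
    rw [show k + i + (j - i) = k + j by omega] at e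
    have z : ∑ t ∈ Finset.range (j - i), cn V (k + i + t) = 0 := Finset.sum_eq_zero (fun t ht => by
      rw [Finset.mem_range] at ht
      unfold cn
      rw [if_neg]
      rw [add_assoc, hc _ (by omega)]; omega)
    rw [z] at w1 w2
    rw [e]
    exact mul_neg_of_pos_of_neg hR (Real.sin_neg_of_neg_of_neg_pi_lt w1 (by linarith))
  · intro i j hi hj
    obtain ⟨R, hR, e⟩ := h.crs_sin (k + i) (p - i + j)
    obtain ⟨w1, w2⟩ := h.window hA h3 (k + i) (p - i + j) (by omega) (by omega)
    rw [show k + i + (p - i + j) = k + p + j by omega] at e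
    have z : ∑ t ∈ Finset.range (p - i + j), cn V (k + i + t) = Real.pi := by
      rw [Finset.sum_eq_single (p - i - 1)]
      · unfold cn; rw [if_pos]
        rw [add_assoc, hc _ (by omega)]; omega
      · intro t ht hne
        rw [Finset.mem_range] at ht
        unfold cn
        rw [if_neg]
        rw [add_assoc, hc _ (by omega)]; omega
      · intro hh; exfalso; apply hh; rw [Finset.mem_range]; omega
    rw [z] at w1 w2
    rw [e]
    exact mul_pos hR (Real.sin_pos_of_pos_of_lt_pi (by linarith) w1)

lemma CP.forward (h : CP N V) (hA : 0 < AA N V)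
    (hcard : ((Finset.range (N + 3)).filter (fun j => 0 < crs (dd V j) (dd V (j + 1)))).card = 3) :
    ∃ k p q r, 1 ≤ p ∧ 1 ≤ q ∧ 1 ≤ r ∧ p + q + r = N + 3 ∧ HP (dd V) k p q ∧ HP (dd V) (k + p) q r ∧
      HP (dd V) (k + p + q) r p := by
  have hfe : (Finset.range (N + 3)).filter (fun j => 0 < crs (dd V j) (dd V (j + 1)))
      = (Finset.range (N + 3)).filter (fun j => 0 < tn V j) :=
    Finset.filter_congr (fun j _ => (h.tn_pos j).symm)
  rw [hfe] at hcard
  set S := (Finset.range (N + 3)).filter (fun j => 0 < tn V j) with hS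
  have h3 : ∑ j ∈ Finset.range (N + 3), cn V j = 3 * Real.pi := by
    unfold cn
    rw [← Finset.sum_filter, Finset.sum_const, hcard]; simp
  set f := S.orderEmbOfFin hcard with hf
  have l1 : f 0 < f 1 := f.strictMono (by decide)
  have l2 : f 1 < f 2 := f.strictMono (by decide)
  have hm : ∀ x, x ∈ S ↔ x = f 0 ∨ x = f 1 ∨ x = f 2 := by
    intro x
    have : x ∈ (S : Set ℕ) ↔ x ∈ Set.range f := by rw [hf, Finset.range_orderEmbOfFin]
    rw [Finset.mem_coe] at this
    rw [this]
    constructor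
    · rintro ⟨i, rfl⟩; fin_cases i <;> simp
    · rintro (h | h | h) <;> exact ⟨_, h.symm⟩
  have l3 : f 2 < N + 3 := by
    have := (hm (f 2)).2 (by simp)
    rw [hS, Finset.mem_filter, Finset.mem_range] at this
    exact this.1
  generalize f 0 = a at *
  generalize f 1 = b at *
  generalize f 2 = c at *
  have hpos : ∀ x, x < N + 3 → (0 < tn V x ↔ x = a ∨ x = b ∨ x = c) := by
    intro x hx
    rw [← hm, hS, Finset.mem_filter, Finset.mem_range]; tauto
  have hpos2 : ∀ x, N + 3 ≤ x → x < 2 * (N + 3) → (0 < tn V x ↔ x = a + (N + 3) ∨ x = b + (N + 3) ∨ x = c + (N + 3)) := by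
    intro x hx hx2
    have := h.tn_per (x - (N + 3))
    rw [show x - (N + 3) + (N + 3) = x by omega] at this
    rw [this, hpos _ (by omega)]; omega
  have hpp : ∀ x, x < 2 * (N + 3) → (0 < tn V x ↔ x = a ∨ x = b ∨ x = c ∨ x = a + (N + 3) ∨ x = b + (N + 3) ∨ x = c + (N + 3)) := by
    intro x hx
    by_cases h' : x < N + 3
    · rw [hpos x h']; omega
    · rw [hpos2 x (by omega) hx]; omega
  refine ⟨a + 1, b - a, c - b, N + 3 - c + a, by omega, by omega, by omega, by omega, ?_, ?_, ?_⟩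
  · apply h.half hA h3 _ _ _ (by omega)
    intro t ht; rw [hpp _ (by omega)]; omega
  · apply h.half hA h3 _ _ _ (by omega)
    intro t ht; rw [hpp _ (by omega)]; omega
  · apply h.half hA h3 _ _ _ (by omega)
    intro t ht; rw [hpp _ (by omega)]; omega

end Part6

section Part7
variable {N : ℕ} {V : ℕ → ℂ}

lemma crs_add_right (e a b : ℂ) : crs e (a + b) = crs e a + crs e b := by simp [crs]; ring
lemma crs_add_left (e a b : ℂ) : crs (a + b) e = crs a e + crs b e := by simp [crs]; ring
lemma crs_neg_left (e a : ℂ) : crs (-e) a = - crs e a := by simp [crs]; ring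
lemma crs_neg_right (e a : ℂ) : crs e (-a) = - crs e a := by simp [crs]; ring
lemma crs_swap (e a : ℂ) : crs e a = - crs a e := by simp [crs]; ring
lemma crs_self (e : ℂ) : crs e e = 0 := by simp [crs]; ring
lemma crs_smul_right (e a : ℂ) (t : ℝ) : crs e (t * a) = t * crs e a := by simp [crs]; ring
lemma crs_smul_left (e a : ℂ) (t : ℝ) : crs (t * a) e = t * crs a e := by simp [crs]; ring
lemma crs_zero_left (e : ℂ) : crs 0 e = 0 := by simp [crs]
lemma crs_zero_right (e : ℂ) : crs e 0 = 0 := by simp [crs]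

lemma tele (V : ℕ → ℂ) (e : ℂ) (a b : ℕ) (hab : a < b)
    (h : ∀ z, a ≤ z → z < b → 0 < crs e (dd V z)) : 0 < crs e (V b - V a) := by
  induction b, hab using Nat.le_induction with
  | base => exact h a le_rfl (by omega)
  | succ b hb ih =>
    have h1 := ih (fun z h1 h2 => h z h1 (by omega))
    have h2 := h b (by omega) (by omega)
    have : V (b + 1) - V a = (V b - V a) + dd V b := by unfold dd; ring
    rw [this, crs_add_right]; linarith

lemma HP.sep {k p q : ℕ} (h : HP (dd V) k p q) (x y : ℕ) (hx : k ≤ x) (hxp : x < k + p) (hxy : x < y)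
    (hy : y < k + p + q) (s t : ℝ) (_hs0 : 0 ≤ s) (hs1 : s ≤ 1) (ht0 : 0 ≤ t) (_ht1 : t ≤ 1)
    (he : V x + s * dd V x = V y + t * dd V y) : y = x + 1 ∧ t = 0 := by
  have key : (((1 - s : ℝ) : ℂ) * dd V x + (V y - V (x + 1)) + t * dd V y) = 0 := by
    have : V (x + 1) = V x + dd V x := by unfold dd; ring
    rw [this]; push_cast
    linear_combination -he
  have hneg : ∀ z, x < z → z < k + p → crs (dd V x) (dd V z) < 0 := by
    intro z h1 h2
    have := h.neg (x - k) (z - k) (by omega) (by omega)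
    rwa [show k + (x - k) = x by omega, show k + (z - k) = z by omega] at this
  have hpos : ∀ x z, k ≤ x → x < k + p → k + p ≤ z → z < k + p + q → 0 < crs (dd V x) (dd V z) := by
    intro x z h0 h1 h2 h3
    have := h.pos (x - k) (z - (k + p)) (by omega) (by omega)
    rwa [show k + (x - k) = x by omega, show k + p + (z - (k + p)) = z by omega] at this
  by_cases hyp : y < k + p
  · have hk := congrArg (crs (dd V x)) key
    rw [crs_add_right, crs_add_right, crs_smul_right, crs_smul_right, crs_self, crs_zero_right] at hk
    have h2 := hneg y hxy hyp
    by_cases h1 : y = x + 1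
    · refine ⟨h1, ?_⟩
      subst h1
      rw [sub_self, crs_zero_right] at hk
      simp only [mul_zero, zero_add, mul_eq_zero] at hk
      rcases hk with hk | hk
      · exact hk
      · linarith
    · exfalso
      have := tele V (-(dd V x)) (x + 1) y (by omega) (fun z h1 h2 => by
        rw [crs_neg_left]; linarith [hneg z (by omega) (by omega)])
      rw [crs_neg_left] at this
      nlinarith
  · push Not at hyp
    set u : ℂ := ((1 - s : ℝ) : ℂ) * dd V x + (V (k + p) - V (x + 1)) with hu
    set w : ℂ := (V y - V (k + p)) + t * dd V y with hw
    have huw : u + w = 0 := by rw [← key, hu, hw]; ring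
    have hw' : w = -u := by linear_combination huw
    have huw0 : crs u w = 0 := by rw [hw', crs_neg_right, crs_self, neg_zero]
    by_cases ht : t = 0 ∧ y = k + p
    · obtain ⟨ht, hyk⟩ := ht
      refine ⟨?_, ht⟩
      by_contra hne
      have hw0 : w = 0 := by rw [hw, hyk, ht]; simp
      have hu0 : u = 0 := by rw [hw0, add_zero] at huw; exact huw
      have h1 := hpos x y hx hxp hyp hy
      have h2 := tele V (-(dd V y)) (x + 1) (k + p) (by omega) (fun z h1 h2 => by
        rw [crs_neg_left, ← crs_swap]; exact hpos z y (by omega) (by omega) hyp hy)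
      have h3 : crs (-(dd V y)) u = 0 := by rw [hu0, crs_zero_right]
      rw [hu, crs_add_right, crs_smul_right, crs_neg_left (dd V y) (dd V x), ← crs_swap] at h3
      have : 0 ≤ (1 - s) * crs (dd V x) (dd V y) := mul_nonneg (by linarith) h1.le
      linarith
    · exfalso
      have hew : ∀ z, k ≤ z → z < k + p → 0 < crs (dd V z) w := by
        intro z h1 h2
        rw [hw, crs_add_right, crs_smul_right]
        have h3 := hpos z y h1 h2 hyp hy
        rcases hyp.lt_or_eq with h4 | h4
        · have := tele V (dd V z) (k + p) y h4 (fun z' h5 h6 => hpos z z' h1 h2 h5 (by omega))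
          have : 0 ≤ t * crs (dd V z) (dd V y) := mul_nonneg ht0 h3.le
          linarith
        · rw [← h4, sub_self, crs_zero_right, zero_add, h4]
          have : t ≠ 0 := fun h' => ht ⟨h', h4.symm⟩
          exact mul_pos (lt_of_le_of_ne ht0 this.symm) h3
      have h1 := hew x hx hxp
      have h5 : crs u w = (1 - s) * crs (dd V x) w + crs (-w) (V (k + p) - V (x + 1)) := by
        rw [hu, crs_add_left, crs_smul_left, crs_neg_left, ← crs_swap]
      have h6 : 0 ≤ (1 - s) * crs (dd V x) w := mul_nonneg (by linarith) h1.le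
      by_cases hxk : x + 1 = k + p
      · rw [← hxk, sub_self, crs_zero_right, add_zero, huw0] at h5
        have : 1 - s = 0 := by
          rcases mul_eq_zero.1 h5.symm with h | h
          · exact h
          · linarith
        have hu0 : u = 0 := by rw [hu, this, ← hxk]; simp
        rw [hw', hu0, neg_zero, crs_zero_right] at h1
        exact lt_irrefl _ h1
      · have := tele V (-w) (x + 1) (k + p) (by omega) (fun z h1 h2 => by
          rw [crs_neg_left, ← crs_swap]; exact hew z (by omega) h2)
        linarith

lemma mem_seg_dd {z : ℂ} {x : ℕ} (h : z ∈ segment ℝ (V x) (V (x + 1))) :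
    ∃ s : ℝ, 0 ≤ s ∧ s ≤ 1 ∧ V x + s * dd V x = z := by
  rw [segment_eq_image'] at h
  obtain ⟨s, hs, e⟩ := h
  exact ⟨s, hs.1, hs.2, by simpa [dd] using e⟩

lemma HP.dis {k p q : ℕ} (h : HP (dd V) k p q) (x y : ℕ) (hx : k ≤ x) (hxp : x < k + p) (hxy : x + 2 ≤ y)
    (hy : y < k + p + q) :
    Disjoint (segment ℝ (V x) (V (x + 1))) (segment ℝ (V y) (V (y + 1))) := by
  rw [Set.disjoint_left]
  intro z h1 h2
  obtain ⟨s, s0, s1, hs⟩ := mem_seg_dd h1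
  obtain ⟨t, t0, t1, ht⟩ := mem_seg_dd h2
  have := h.sep x y hx hxp (by omega) hy s t s0 s1 t0 t1 (hs.trans ht.symm)
  omega

lemma HP.inter {k p q : ℕ} (h : HP (dd V) k p q) (hq : 1 ≤ q) (x : ℕ) (hx : k ≤ x) (hxp : x < k + p) :
    segment ℝ (V x) (V (x + 1)) ∩ segment ℝ (V (x + 1)) (V (x + 2)) = {V (x + 1)} := by
  ext z
  constructor
  · rintro ⟨h1, h2⟩
    obtain ⟨s, s0, s1, hs⟩ := mem_seg_dd h1
    obtain ⟨t, t0, t1, ht⟩ := mem_seg_dd h2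
    have := (h.sep x (x + 1) hx hxp (by omega) (by omega) s t s0 s1 t0 t1 (hs.trans ht.symm)).2
    rw [← ht, this]; simp
  · intro hz
    rw [Set.mem_singleton_iff] at hz
    rw [hz]
    exact ⟨right_mem_segment _ _ _, left_mem_segment _ _ _⟩

lemma HP.turn {k p q : ℕ} (h : HP (dd V) k p q) (hq : 1 ≤ q) (x : ℕ) (hx : k ≤ x) (hxp : x < k + p) :
    (crs (dd V x) (dd V (x + 1)) < 0 ∧ x + 1 < k + p) ∨ (0 < crs (dd V x) (dd V (x + 1)) ∧ x + 1 = k + p) := by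
  by_cases h1 : x + 1 < k + p
  · left
    have := h.neg (x - k) (x - k + 1) (by omega) (by omega)
    rw [show k + (x - k) = x by omega, show k + (x - k + 1) = x + 1 by omega] at this
    exact ⟨this, h1⟩
  · right
    have := h.pos (x - k) 0 (by omega) (by omega)
    rw [show k + (x - k) = x by omega, show k + p + 0 = x + 1 by omega] at this
    exact ⟨this, by omega⟩

lemma HP.tnsum {k p q : ℕ} (hC : CP N V) (h : HP (dd V) k p q) (hp1 : 1 ≤ p) (hq : 1 ≤ q) :
    0 < ∑ t ∈ Finset.range p, tn V (k + t) := by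
  have hp := Real.pi_pos
  have step : ∀ m, m < p → -Real.pi < (∑ t ∈ Finset.range m, tn V (k + t)) ∧
      (∑ t ∈ Finset.range m, tn V (k + t)) ≤ 0 := by
    intro m
    induction m with
    | zero => intro _; simp [hp]
    | succ m ih =>
      intro hm
      obtain ⟨h1, h2⟩ := ih (by omega)
      obtain ⟨R, hR, e⟩ := hC.crs_sin k (m + 1)
      have h3 := h.neg 0 (m + 1) (by omega) hm
      rw [add_zero] at h3
      have ht : tn V (k + m) ≤ 0 := by
        by_contra hcon
        push Not at hcon
        rw [hC.tn_pos] at hcon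
        have := h.neg m (m + 1) (by omega) hm
        rw [show k + (m + 1) = k + m + 1 by ring] at this
        linarith
      have ht2 := (hC.tn_lt (k + m)).2
      rw [e] at h3
      rw [Finset.sum_range_succ] at h3 ⊢
      refine ⟨?_, by linarith⟩
      by_contra hcon
      push Not at hcon
      have h4 : 0 ≤ Real.sin (∑ t ∈ Finset.range m, tn V (k + t) + tn V (k + m)) := by
        rw [← Real.sin_add_two_pi]
        apply Real.sin_nonneg_of_nonneg_of_le_pi <;> linarith
      have := mul_nonneg hR.le h4
      linarith
  obtain ⟨m, rfl⟩ : ∃ m, p = m + 1 := ⟨p - 1, by omega⟩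
  obtain ⟨h1, h2⟩ := step m (by omega)
  obtain ⟨R, hR, e⟩ := hC.crs_sin k (m + 1)
  have h3 := h.pos 0 0 (by omega) (by omega)
  simp only [add_zero] at h3
  rw [e] at h3
  have ht : 0 < tn V (k + m) := by
    rw [hC.tn_pos]
    have := h.pos m 0 (by omega) (by omega)
    rwa [add_zero] at this
  have ht2 := (hC.tn_lt (k + m)).1
  rw [Finset.sum_range_succ] at h3 ⊢
  by_contra hcon
  push Not at hcon
  have h4 := Real.sin_nonpos_of_nonpos_of_neg_pi_le hcon (by linarith)
  have := mul_nonneg hR.le (neg_nonneg.2 h4)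
  linarith

lemma HP.backward {p q r : ℕ} (hp1 : 1 ≤ p) (hq1 : 1 ≤ q) (hr1 : 1 ≤ r) (hn : p + q + r = N + 3)
    (hper : ∀ i, V (i + (N + 3)) = V i)
    (h1 : HP (dd V) 0 p q) (h2 : HP (dd V) p q r) (h3 : HP (dd V) (p + q) r p) :
    CP N V ∧ 0 < AA N V ∧
      (∀ j, j < N + 3 → (0 < crs (dd V j) (dd V (j + 1)) ↔ j + 1 = p ∨ j + 1 = p + q ∨ j + 1 = p + q + r)) := by
  have hmod : ∀ k m, V (m + (N + 3) * k) = V m := by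
    intro k m
    induction k with
    | zero => simp
    | succ k ih => rw [show m + (N + 3) * (k + 1) = m + (N + 3) * k + (N + 3) by ring, hper, ih]
  have tr : ∀ j, j < N + 3 → (crs (dd V j) (dd V (j + 1)) < 0 ∧ ¬ (j + 1 = p ∨ j + 1 = p + q ∨ j + 1 = p + q + r))
      ∨ (0 < crs (dd V j) (dd V (j + 1)) ∧ (j + 1 = p ∨ j + 1 = p + q ∨ j + 1 = p + q + r)) := by
    intro j hj
    rcases lt_or_ge j p with hj1 | hj1
    · rcases h1.turn hq1 j (by omega) (by omega) with h | h
      · left; exact ⟨h.1, by omega⟩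
      · right; exact ⟨h.1, by omega⟩
    rcases lt_or_ge j (p + q) with hj2 | hj2
    · rcases h2.turn hr1 j (by omega) (by omega) with h | h
      · left; exact ⟨h.1, by omega⟩
      · right; exact ⟨h.1, by omega⟩
    · rcases h3.turn hp1 j (by omega) (by omega) with h | h
      · left; exact ⟨h.1, by omega⟩
      · right; exact ⟨h.1, by omega⟩
  have red : ∀ (P : ℕ → Prop), (∀ x, P (x + (N + 3)) ↔ P x) → (∀ x, x < N + 3 → P x) → ∀ x, P x := by
    intro P hP hx x
    have : ∀ k m, P (m + (N + 3) * k) ↔ P m := by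
      intro k m
      induction k with
      | zero => simp
      | succ k ih => rw [show m + (N + 3) * (k + 1) = m + (N + 3) * k + (N + 3) by ring, hP, ih]
    rw [← Nat.mod_add_div x (N + 3), this]
    exact hx _ (Nat.mod_lt _ (by omega))
  have hper1 : ∀ i a, V (i + (N + 3) + a) = V (i + a) := fun i a => by
    rw [show i + (N + 3) + a = i + a + (N + 3) by ring, hper]
  have hC : CP N V := by
    refine ⟨hper, ?_, ?_, ?_⟩
    · have : ∀ x m, 2 ≤ m → m ≤ N + 1 →
        Disjoint (segment ℝ (V x) (V (x + 1))) (segment ℝ (V (x + m)) (V (x + m + 1))) := by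
        intro x m hm1 hm2
        revert x
        apply red
        · intro x
          rw [add_assoc (x + (N + 3)) m 1, hper1, hper1, hper1, hper, add_assoc]
        · intro x hx
          have wrap : N + 3 ≤ x + m → Disjoint (segment ℝ (V (x + m - (N + 3))) (V (x + m - (N + 3) + 1)))
              (segment ℝ (V x) (V (x + 1))) →
              Disjoint (segment ℝ (V x) (V (x + 1))) (segment ℝ (V (x + m)) (V (x + m + 1))) := by
            intro hh h'
            have e1 : V (x + m) = V (x + m - (N + 3)) := by
              rw [← hper (x + m - (N + 3))]; congr 1; omega
            have e2 : V (x + m + 1) = V (x + m - (N + 3) + 1) := by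
              rw [← hper (x + m - (N + 3) + 1)]; congr 1; omega
            rw [e1, e2]; exact h'.symm
          have wrap2 : Disjoint (segment ℝ (V (x + m)) (V (x + m + 1)))
              (segment ℝ (V (x + (N + 3))) (V (x + (N + 3) + 1))) →
              Disjoint (segment ℝ (V x) (V (x + 1))) (segment ℝ (V (x + m)) (V (x + m + 1))) := by
            intro h'
            rw [hper1, hper] at h'
            exact h'.symm
          rcases lt_or_ge x p with hj1 | hj1
          · rcases lt_or_ge (x + m) (p + q) with a1 | a1
            · exact h1.dis _ _ (by omega) (by omega) (by omega) (by omega)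
            rcases lt_or_ge (x + m) (N + 3) with a2 | a2
            · exact wrap2 (h3.dis _ _ (by omega) (by omega) (by omega) (by omega))
            · exact wrap a2 (h1.dis _ _ (by omega) (by omega) (by omega) (by omega))
          rcases lt_or_ge x (p + q) with hj2 | hj2
          · rcases lt_or_ge (x + m) (N + 3) with a1 | a1
            · exact h2.dis _ _ (by omega) (by omega) (by omega) (by omega)
            rcases lt_or_ge (x + m) (N + 3 + p) with a2 | a2
            · exact wrap a1 (h1.dis _ _ (by omega) (by omega) (by omega) (by omega))
            · exact wrap a1 (h2.dis _ _ (by omega) (by omega) (by omega) (by omega))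
          · rcases lt_or_ge (x + m) (N + 3 + p) with a1 | a1
            · exact h3.dis _ _ (by omega) (by omega) (by omega) (by omega)
            rcases lt_or_ge (x + m) (N + 3 + p + q) with a2 | a2
            · exact wrap (by omega) (h2.dis _ _ (by omega) (by omega) (by omega) (by omega))
            · exact wrap (by omega) (h3.dis _ _ (by omega) (by omega) (by omega) (by omega))
      intro i j h1 h2
      have := this i (j - i) (by omega) (by omega)
      rwa [show i + (j - i) = j by omega] at this
    · apply red
      · intro x
        rw [hper1, hper1, hper]
      · intro x hx
        rcases tr x hx with h | h
        · exact h.1.ne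
        · exact h.1.ne'
    · apply red
      · intro x
        rw [hper1, hper1, hper]
      · intro x hx
        rcases lt_or_ge x p with hj1 | hj1
        · exact h1.inter hq1 x (by omega) (by omega)
        rcases lt_or_ge x (p + q) with hj2 | hj2
        · exact h2.inter hr1 x (by omega) (by omega)
        · exact h3.inter hp1 x (by omega) (by omega)
  refine ⟨hC, ?_, ?_⟩
  · have t1 := h1.tnsum hC hp1 hq1
    have t2 := h2.tnsum hC hq1 hr1
    have t3 := h3.tnsum hC hr1 hp1
    have hT := hC.total
    change _ = 2 * KK N V at hT
    rw [← hn, Finset.sum_range_add, Finset.sum_range_add] at hT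
    simp only [zero_add] at t1
    have hp := Real.pi_pos
    rcases hC.area with h | h
    · exact h.2
    · linarith [h.1]
  · intro j hj
    rcases tr j hj with h | h
    · constructor
      · intro h'; linarith [h.1]
      · intro h'; exact absurd h' h.2
    · exact ⟨fun _ => h.2, fun _ => h.1⟩

end Part7

section Part8
/-- edge vectors of a pseudo-triangle, by side chains. -/
structure PT (L1 L2 L3 : List ℂ) : Prop where
  s : L1.sum + L2.sum + L3.sum = 0
  n1 : L1.Pairwise (fun a b => crs a b < 0)
  n2 : L2.Pairwise (fun a b => crs a b < 0)
  n3 : L3.Pairwise (fun a b => crs a b < 0)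
  c12 : ∀ e ∈ L1, ∀ f ∈ L2, 0 < crs e f
  c23 : ∀ e ∈ L2, ∀ f ∈ L3, 0 < crs e f
  c31 : ∀ e ∈ L3, ∀ f ∈ L1, 0 < crs e f

/-- vertices of a path with given edge vectors (without the end). -/
def verts (a : ℂ) : List ℂ → List ℂ
  | [] => []
  | d :: L => a :: verts (a + d) L

lemma verts_append (a : ℂ) (L M : List ℂ) : verts a (L ++ M) = verts a L ++ verts (a + L.sum) M := by
  induction L generalizing a with
  | nil => simp [verts]
  | cons d L ih => simp [verts, ih, add_assoc]

lemma verts_length (a : ℂ) (L : List ℂ) : (verts a L).length = L.length := by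
  induction L generalizing a with
  | nil => simp [verts]
  | cons d L ih => simp [verts, ih]

lemma PT.rot {L1 L2 L3 : List ℂ} (h : PT L1 L2 L3) : PT L2 L3 L1 :=
  ⟨by linear_combination h.s, h.n2, h.n3, h.n1, h.c23, h.c31, h.c12⟩

/-- the vertex list spans a standard pseudo-triangle. -/
def Good (S : List ℂ) : Prop := ∃ a L1 L2 L3, PT L1 L2 L3 ∧ 2 ≤ L1.length ∧ 2 ≤ L2.length ∧
  2 ≤ L3.length ∧ (verts a (L1 ++ L2 ++ L3)).Perm S

lemma Good.perm {S T : List ℂ} (h : Good S) (hp : S.Perm T) : Good T := by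
  obtain ⟨a, L1, L2, L3, h1, h2, h3, h4, h5⟩ := h
  exact ⟨a, L1, L2, L3, h1, h2, h3, h4, h5.trans hp⟩

lemma verts_rot (a : ℂ) (L M : List ℂ) (h : L.sum + M.sum = 0) :
    (verts (a + L.sum) (M ++ L)).Perm (verts a (L ++ M)) := by
  rw [verts_append, verts_append, add_assoc, h, add_zero]
  exact List.perm_append_comm

lemma PT.good_rot {L1 L2 L3 : List ℂ} (h : PT L1 L2 L3) (a : ℂ)
    (hg : ∀ b, Good (verts b (L2 ++ L3 ++ L1))) : Good (verts a (L1 ++ L2 ++ L3)) := by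
  refine (hg (a + L1.sum)).perm ?_
  rw [List.append_assoc L1]
  exact verts_rot a L1 (L2 ++ L3) (by rw [List.sum_append]; linear_combination h.s)

lemma plk (a w e f : ℂ) : crs a w * crs e f = crs a e * crs w f + crs a f * crs e w := by
  simp [crs]; ring

lemma sum_nonneg_r (x : ℂ) (L : List ℂ) (h : ∀ e ∈ L, 0 < crs x e) : 0 ≤ crs x L.sum := by
  induction L with
  | nil => simp [crs]
  | cons d L ih =>
    rw [List.sum_cons, crs_add_right]
    have := h d (by simp)
    have := ih (fun e he => h e (by simp [he]))
    linarith

lemma sum_pos_r (x : ℂ) (L : List ℂ) (hL : L ≠ []) (h : ∀ e ∈ L, 0 < crs x e) : 0 < crs x L.sum := by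
  cases L with
  | nil => exact absurd rfl hL
  | cons d L =>
    rw [List.sum_cons, crs_add_right]
    have := h d (by simp)
    have := sum_nonneg_r x L (fun e he => h e (by simp [he]))
    linarith

lemma sum_nonneg_l (x : ℂ) (L : List ℂ) (h : ∀ e ∈ L, 0 < crs e x) : 0 ≤ crs L.sum x := by
  rw [crs_swap, ← crs_neg_left]
  exact sum_nonneg_r _ L (fun e he => by rw [crs_neg_left, ← crs_swap]; exact h e he)

lemma sum_pos_l (x : ℂ) (L : List ℂ) (hL : L ≠ []) (h : ∀ e ∈ L, 0 < crs e x) : 0 < crs L.sum x := by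
  rw [crs_swap, ← crs_neg_left]
  exact sum_pos_r _ L hL (fun e he => by rw [crs_neg_left, ← crs_swap]; exact h e he)

lemma PT.lemA {L1 F1 F2 L3 : List ℂ} {x : ℂ} (h : PT L1 (F1 ++ x :: F2) L3) (h1 : L1 ≠ []) (h3 : L3 ≠ []) :
    0 < crs x (x + F2.sum + L3.sum) := by
  have hs := h.s
  have hn := h.n2
  rw [List.pairwise_append, List.pairwise_cons] at hn
  obtain ⟨hF1, ⟨hxF2, hF2⟩, hF1x⟩ := hn
  simp only [List.sum_append, List.sum_cons] at hs
  have hEx : 0 < crs L1.sum x := sum_pos_l x L1 h1 (fun e he => h.c12 e he x (by simp))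
  by_cases hF : F1 = []
  · subst hF
    simp only [List.sum_nil, zero_add] at hs
    have : x + F2.sum + L3.sum = -L1.sum := by linear_combination hs
    rw [this, crs_neg_right, ← crs_swap]; exact hEx
  · set B := F1.sum
    set C := x + F2.sum with hC
    set G := L3.sum
    have hE : L1.sum = -(B + C + G) := by linear_combination hs
    have hBx : crs B x < 0 := by
      have := sum_pos_l (-x) F1 hF (fun e he => by
        rw [crs_neg_right]; linarith [hF1x e he x (by simp)])
      rw [crs_neg_right] at this; linarith
    have hxF : crs x F2.sum ≤ 0 := by
      have := sum_nonneg_r (-x) F2 (fun e he => by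
        rw [crs_neg_left]; linarith [hxF2 e he])
      rw [crs_neg_left] at this; linarith
    have hxC : crs x C ≤ 0 := by rw [hC, crs_add_right, crs_self]; linarith
    have hBF : crs B F2.sum ≤ 0 := by
      by_cases hF20 : F2 = []
      · rw [hF20]; simp [crs]
      · have := sum_nonneg_l (-F2.sum) F1 (fun e he => by
          rw [crs_neg_right, ← crs_neg_left]
          exact sum_pos_r _ F2 hF20
            (fun f hf => by rw [crs_neg_left]; linarith [hF1x e he f (by simp [hf])]))
        rw [crs_neg_right] at this; linarith
    have hBC : crs B C < 0 := by rw [hC, crs_add_right]; linarith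
    have hCG : 0 < crs C G := by
      have : 0 < crs (x :: F2).sum G := sum_pos_l _ _ (by simp) (fun e he =>
        sum_pos_r _ _ h3 (fun f hf => h.c23 e (by simp at he ⊢; tauto) f hf))
      rwa [List.sum_cons] at this
    have hEB : 0 < crs L1.sum B := sum_pos_l _ _ h1 (fun e he =>
        sum_pos_r _ _ hF (fun f hf => h.c12 e he f (by simp [hf])))
    -- barycentric identity at the start of the edge
    have key : (-crs B C) * crs x (C + G) = (crs C G) * (-(crs B x)) + (crs L1.sum B) * (-(crs x C)) := by
      rw [hE]; simp [crs]; ring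
    have : 0 < (-crs B C) * crs x (C + G) := by
      rw [key]
      have a1 := mul_pos hCG (neg_pos.2 hBx)
      have a2 := mul_nonneg hEB.le (neg_nonneg.2 hxC)
      linarith
    exact (pos_iff_pos_of_mul_pos this).1 (by linarith)

end Part8

section Part9
/-- earlier edges of the middle chain see `f + L3.sum` on the left. -/
lemma PT.lemA' {L1 F L3 : List ℂ} {f : ℂ} (h : PT L1 (F ++ [f]) L3) (h1 : L1 ≠ []) (h3 : L3 ≠ []) :
    ∀ x ∈ F ++ [f], 0 < crs x (f + L3.sum) := by
  intro x hx
  rw [List.mem_append, List.mem_singleton] at hx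
  rcases hx with hx | rfl
  · obtain ⟨F1, F2, rfl⟩ := List.append_of_mem hx
    have hA := PT.lemA (F1 := F1) (F2 := F2 ++ [f]) (x := x) (by simpa using h) h1 h3
    have hn := h.n2
    rw [List.append_assoc, List.pairwise_append, List.cons_append, List.pairwise_cons] at hn
    have := sum_nonneg_r (-x) F2 (fun e he => by
      rw [crs_neg_left]; linarith [hn.2.1.1 e (by simp [he])])
    rw [crs_neg_left] at this
    simp only [List.sum_append, List.sum_cons, List.sum_nil, add_zero, crs_add_right, crs_self] at hA ⊢
    linarith
  · have := PT.lemA (F1 := F) (F2 := []) (x := x) h h1 h3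
    simpa using this

lemma PT.M1 {E F : List ℂ} {e f' f g : ℂ} (h : PT (e :: E) (F ++ [f', f]) [g])
    (hB : 0 < crs (f + g) e) : PT (e :: E) (F ++ [f' + f]) [-f, f + g] := by
  have hA := PT.lemA' (F := F ++ [f']) (f := f) (by simpa using h) (by simp) (by simp)
  have hn := h.n2
  rw [List.pairwise_append] at hn
  obtain ⟨nF, nff, nx⟩ := hn
  have nff' : crs f' f < 0 := by simpa using nff
  have hfg : 0 < crs f g := h.c23 f (by simp) g (by simp)
  have hn1 := h.n1
  rw [List.pairwise_cons] at hn1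
  refine ⟨?_, h.n1, ?_, ?_, ?_, ?_, ?_⟩
  · have := h.s
    simp only [List.sum_append, List.sum_cons, List.sum_nil] at this ⊢
    linear_combination this
  · rw [List.pairwise_append]
    refine ⟨nF, by simp, ?_⟩
    intro x hx y hy
    rw [List.mem_singleton] at hy
    rw [hy, crs_add_right]
    linarith [nx x hx f' (by simp), nx x hx f (by simp)]
  · simp only [List.pairwise_cons, List.mem_singleton, forall_eq, List.not_mem_nil,
      false_imp_iff, implies_true, List.Pairwise.nil, and_true]
    rw [crs_neg_left, crs_add_right, crs_self]; linarith
  · intro x hx y hy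
    rw [List.mem_append, List.mem_singleton] at hy
    rcases hy with hy | rfl
    · exact h.c12 x hx y (by simp [hy])
    · rw [crs_add_right]
      linarith [h.c12 x hx f' (by simp), h.c12 x hx f (by simp)]
  · intro x hx y hy
    rw [List.mem_append, List.mem_singleton] at hx
    simp only [List.mem_cons, List.not_mem_nil, or_false] at hy
    rcases hy with rfl | rfl
    · rcases hx with hx | rfl
      · rw [crs_neg_right]; linarith [nx x hx f (by simp)]
      · rw [crs_neg_right, crs_add_left, crs_self]; linarith
    · simp only [List.sum_cons, List.sum_nil, add_zero] at hA
      rcases hx with hx | rfl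
      · exact hA x (by simp [hx])
      · rw [crs_add_left]
        linarith [hA f' (by simp), hA f (by simp)]
  · intro x hx y hy
    simp only [List.mem_cons, List.not_mem_nil, or_false] at hx
    rcases hx with rfl | rfl
    · rw [crs_neg_left, ← crs_swap]; exact h.c12 y hy f (by simp)
    · rcases List.mem_cons.1 hy with rfl | hy'
      · exact hB
      · have hge : 0 < crs g e := h.c31 g (by simp) e (by simp)
        have hgy : 0 < crs g y := h.c31 g (by simp) y hy
        have hey := hn1.1 y hy'
        have key : crs (f + g) y * crs g e = crs (f + g) e * crs g y + (- crs e y) * crs f g := by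
          simp [crs]; ring
        have : 0 < crs (f + g) y * crs g e := by
          rw [key]
          have a1 := mul_pos hB hgy
          have a2 := mul_pos (neg_pos.2 hey) hfg
          linarith
        exact (pos_iff_pos_of_mul_pos this).2 hge

lemma PT.imposs {E F : List ℂ} {e f g : ℂ} (h : PT (e :: E) (F ++ [f]) [g]) (hE : E ≠ []) (hF : F ≠ [])
    (h1 : crs (f + g) e ≤ 0) : 0 < crs f (g + e) := by
  by_contra h2
  push Not at h2
  have hs := h.s
  simp only [List.sum_append, List.sum_cons, List.sum_nil, add_zero] at hs
  have hn1 := h.n1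
  rw [List.pairwise_cons] at hn1
  have a1 : 0 < crs E.sum F.sum := sum_pos_l _ _ hE (fun x hx => sum_pos_r _ _ hF (fun y hy =>
    h.c12 x (by simp [hx]) y (by simp [hy])))
  have a2 : 0 < crs E.sum f := sum_pos_l _ _ hE (fun x hx => h.c12 x (by simp [hx]) f (by simp))
  have a3 : 0 < crs (-e) E.sum := sum_pos_r _ _ hE (fun x hx => by
    rw [crs_neg_left]; linarith [hn1.1 x hx])
  have a4 : 0 < crs e f := h.c12 e (by simp) f (by simp)
  rw [crs_neg_left, ← crs_swap] at a3
  have hw : F.sum = -(e + f + g) - E.sum := by linear_combination hs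
  have key : crs E.sum F.sum * crs e f = crs E.sum e * crs f (g + e) + crs E.sum f * crs (f + g) e := by
    rw [hw]; simp [crs]; ring
  have := mul_pos a1 a4
  rw [key] at this
  nlinarith

lemma PT.Y {M : List ℂ} {e1 e2 f1 f2 f g : ℂ} (h : PT [e1, e2] (f1 :: f2 :: (M ++ [f])) [g])
    (h1 : crs (f + g) e1 ≤ 0) :
    PT [e1 + e2 + f1, -f1] ((f1 + f2) :: (M ++ [f])) [g + e1, -e1] := by
  have hAC : 0 < crs f (g + e1) := PT.imposs (E := [e2]) (F := f1 :: f2 :: M) (by simpa using h) (by simp) (by simp) h1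
  have hs := h.s
  simp only [List.sum_append, List.sum_cons, List.sum_nil, add_zero] at hs
  have hn := h.n2
  have hn' : (f1 :: f2 :: M ++ [f]).Pairwise (fun a b => crs a b < 0) := by simpa using hn
  rw [List.pairwise_append] at hn'
  simp only [List.pairwise_cons] at hn
  obtain ⟨n1, n2, n3⟩ := hn
  have fg : 0 < crs f g := h.c23 f (by simp) g (by simp)
  have ge : 0 < crs g e1 := h.c31 g (by simp) e1 (by simp)
  have ef : ∀ x ∈ f1 :: f2 :: (M ++ [f]), 0 < crs e1 x := fun x hx => h.c12 e1 (by simp) x hx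
  have e2f : ∀ x ∈ f1 :: f2 :: (M ++ [f]), 0 < crs e2 x := fun x hx => h.c12 e2 (by simp) x hx
  have K1 : ∀ x ∈ f1 :: f2 :: (M ++ [f]), 0 < crs x (g + e1) := by
    intro x hx
    have hx' : x ∈ f1 :: f2 :: M ∨ x = f := by simpa [or_assoc] using hx
    rcases hx' with hx' | rfl
    · have hxf := hn'.2.2 x hx' f (by simp)
      have hxg := h.c23 x hx g (by simp)
      have key : crs x (g + e1) * crs f g = crs x f * (-crs g e1) + crs x g * crs f (g + e1) := by
        simp [crs]; ring
      have : 0 < crs x (g + e1) * crs f g := by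
        rw [key]
        have a1 := mul_pos_of_neg_of_neg hxf (neg_neg_iff_pos.2 ge)
        have a2 := mul_pos hxg hAC
        linarith
      exact (pos_iff_pos_of_mul_pos this).2 fg
    · exact hAC
  -- the chord from the start to the first inner vertex
  have hch : e1 + e2 + f1 = -(f2 + (M ++ [f]).sum + g) := by
    simp only [List.sum_append, List.sum_cons, List.sum_nil, add_zero]
    linear_combination hs
  have K2 : ∀ x ∈ f2 :: (M ++ [f]), 0 < crs (e1 + e2 + f1) x := by
    intro x hx
    obtain ⟨F1, F2, hF⟩ := List.append_of_mem hx
    have hA := PT.lemA (L1 := [e1, e2]) (F1 := f1 :: F1) (F2 := F2) (x := x) (L3 := [g])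
      (by rw [hF] at h; simpa using h) (by simp) (by simp)
    have hsum : f2 + (M ++ [f]).sum = F1.sum + (x + F2.sum) := by
      have := congrArg List.sum hF
      simpa using this
    have hnn : (F1 ++ x :: F2).Pairwise (fun a b => crs a b < 0) := by
      rw [← hF]; exact List.pairwise_cons.2 ⟨n2, n3⟩
    rw [List.pairwise_append] at hnn
    have := sum_nonneg_l (-x) F1 (fun y hy => by
      rw [crs_neg_right]; linarith [hnn.2.2 y hy x (by simp)])
    rw [crs_neg_right] at this
    rw [hch, hsum, crs_neg_left, ← crs_swap]
    simp only [List.sum_cons, List.sum_nil, add_zero, crs_add_right, crs_self] at hA ⊢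
    rw [crs_swap x F1.sum]
    linarith
  have K2' : 0 < crs (e1 + e2 + f1) f1 := by
    rw [crs_add_left, crs_add_left, crs_self]
    linarith [ef f1 (by simp), e2f f1 (by simp)]
  refine ⟨?_, ?_, ?_, ?_, ?_, ?_, ?_⟩
  · simp only [List.sum_append, List.sum_cons, List.sum_nil, add_zero]
    linear_combination hs
  · simp only [List.pairwise_cons, List.mem_singleton, forall_eq, List.not_mem_nil,
      false_imp_iff, implies_true, List.Pairwise.nil, and_true]
    rw [crs_neg_right]; linarith
  · rw [List.pairwise_cons]
    refine ⟨fun x hx => ?_, n3⟩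
    rw [crs_add_left]
    linarith [n1 x (by simp only [List.mem_cons]; exact Or.inr hx), n2 x hx]
  · simp only [List.pairwise_cons, List.mem_singleton, forall_eq, List.not_mem_nil,
      false_imp_iff, implies_true, List.Pairwise.nil, and_true]
    rw [crs_neg_right, crs_add_left, crs_self]; linarith
  · intro x hx y hy
    simp only [List.mem_cons, List.not_mem_nil, or_false] at hx
    rcases hx with rfl | rfl <;> rcases List.mem_cons.1 hy with rfl | hy'
    · rw [crs_add_right]; linarith [K2 f2 (by simp)]
    · exact K2 y (List.mem_cons_of_mem _ hy')
    · rw [crs_neg_left, crs_add_right, crs_self]; linarith [n1 f2 (by simp)]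
    · rw [crs_neg_left]; linarith [n1 y (List.mem_cons_of_mem _ hy')]
  · intro x hx y hy
    simp only [List.mem_cons, List.not_mem_nil, or_false] at hy
    rcases hy with rfl | rfl <;> rcases List.mem_cons.1 hx with rfl | hx'
    · rw [crs_add_left]; linarith [K1 f1 (by simp), K1 f2 (by simp)]
    · exact K1 x (List.mem_cons_of_mem _ (List.mem_cons_of_mem _ hx'))
    · rw [crs_neg_right, ← crs_swap, crs_add_right]; linarith [ef f1 (by simp), ef f2 (by simp)]
    · rw [crs_neg_right, ← crs_swap]; exact ef x (List.mem_cons_of_mem _ (List.mem_cons_of_mem _ hx'))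
  · intro x hx y hy
    simp only [List.mem_cons, List.not_mem_nil, or_false] at hx hy
    rcases hx with rfl | rfl <;> rcases hy with rfl | rfl
    · rw [hch, crs_neg_right, ← crs_swap, crs_add_left]
      have := sum_pos_l (g + e1) (f2 :: (M ++ [f])) (by simp) (fun x hx => K1 x (List.mem_cons_of_mem _ hx))
      rw [List.sum_cons] at this
      rw [crs_add_right g, crs_self]; linarith
    · rw [crs_neg_right, ← crs_swap]; exact K1 f1 (by simp)
    · rw [hch, crs_neg_left, crs_neg_right]
      have := sum_pos_r e1 (f2 :: M) (by simp) (fun x hx => ef x (by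
        simp only [List.mem_cons, List.mem_append] at hx ⊢; tauto))
      simp only [List.sum_append, List.sum_cons, List.sum_nil, add_zero, crs_add_right] at this ⊢
      rw [crs_add_left, crs_swap f, crs_swap g] at h1
      linarith
    · rw [crs_neg_left, crs_neg_right]; linarith [ef f1 (by simp)]

end Part9

section Part10
/-- complex conjugation. -/
def cj (d : ℂ) : ℂ := starRingEnd ℂ d

lemma cj_cj (d : ℂ) : cj (cj d) = d := by simp [cj]
lemma cj_add (a b : ℂ) : cj (a + b) = cj a + cj b := by simp [cj]

/-- mirrored chain. -/
def mir (L : List ℂ) : List ℂ := (L.map (fun d => -cj d)).reverse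

lemma crs_cj (a b : ℂ) : crs (-cj a) (-cj b) = crs b a := by simp [crs, cj]; ring

lemma mir_sum (L : List ℂ) : (mir L).sum = - cj L.sum := by
  unfold mir
  rw [List.sum_reverse]
  induction L with
  | nil => simp [cj]
  | cons d L ih => rw [List.map_cons, List.sum_cons, ih, List.sum_cons, cj_add]; ring

lemma mir_pair {L : List ℂ} (h : L.Pairwise (fun a b => crs a b < 0)) :
    (mir L).Pairwise (fun a b => crs a b < 0) := by
  unfold mir
  rw [List.pairwise_reverse, List.pairwise_map]
  exact h.imp (fun {a b} hab => by rw [crs_cj]; exact hab)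

lemma mir_cross {L M : List ℂ} (h : ∀ e ∈ L, ∀ f ∈ M, 0 < crs e f) :
    ∀ e ∈ mir M, ∀ f ∈ mir L, 0 < crs e f := by
  intro e he f hf
  unfold mir at he hf
  rw [List.mem_reverse, List.mem_map] at he hf
  obtain ⟨e', he', rfl⟩ := he
  obtain ⟨f', hf', rfl⟩ := hf
  rw [crs_cj]; exact h f' hf' e' he'

lemma mir_append (L M : List ℂ) : mir (L ++ M) = mir M ++ mir L := by simp [mir]
lemma mir_length (L : List ℂ) : (mir L).length = L.length := by simp [mir]

lemma PT.mir {L1 L2 L3 : List ℂ} (h : PT L1 L2 L3) : PT (mir L2) (mir L1) (mir L3) := by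
  refine ⟨?_, mir_pair h.n2, mir_pair h.n1, mir_pair h.n3, mir_cross h.c12, mir_cross h.c31, mir_cross h.c23⟩
  rw [mir_sum, mir_sum, mir_sum]
  have := congrArg cj h.s
  rw [cj_add, cj_add] at this
  have z : cj 0 = 0 := by simp [cj]
  rw [z] at this
  linear_combination -this

lemma verts_mir0 (L : List ℂ) (a : ℂ) :
    verts (cj (a + L.sum)) (mir L) ++ [cj a] = ((verts a L ++ [a + L.sum]).map cj).reverse := by
  induction L generalizing a with
  | nil => simp [verts, mir]
  | cons d L ih =>
    have e1 : mir (d :: L) = mir L ++ [-cj d] := by simp [mir]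
    have ih' := ih (a + d)
    rw [e1, verts_append, mir_sum]
    have e2 : a + (d :: L).sum = a + d + L.sum := by rw [List.sum_cons]; ring
    have e3 : cj (a + d + L.sum) + -cj L.sum = cj (a + d) := by rw [cj_add _ L.sum]; ring
    rw [e2, e3]
    have e4 : verts (cj (a + d)) [-cj d] = [cj (a + d)] := by simp [verts]
    rw [e4, ih']
    simp [verts]

lemma verts_mir (L : List ℂ) (a : ℂ) (h : L.sum = 0) :
    (verts (cj a) (mir L)).Perm ((verts a L).map cj) := by
  have := verts_mir0 L a
  rw [h, add_zero] at this
  have h2 : (verts (cj a) (mir L) ++ [cj a]).Perm ((verts a L).map cj ++ [cj a]) := by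
    rw [this]
    refine (List.reverse_perm _).trans ?_
    simp
  exact (List.perm_append_right_iff _).1 h2

lemma Good.mir {S : List ℂ} (h : Good S) : Good (S.map cj) := by
  obtain ⟨a, L1, L2, L3, h1, h2, h3, h4, h5⟩ := h
  refine ⟨cj a, _, _, _, h1.mir.rot.rot, ?_, ?_, ?_, ?_⟩
  · rwa [mir_length]
  · rwa [mir_length]
  · rwa [mir_length]
  · rw [List.append_assoc, ← mir_append, ← mir_append]
    refine (verts_mir _ a ?_).trans (h5.map cj)
    rw [List.sum_append, List.sum_append]; exact h1.s

lemma Good.of_mir {S : List ℂ} (h : Good (S.map cj)) : Good S := by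
  have := h.mir
  rw [List.map_map] at this
  have e : cj ∘ cj = id := by funext x; exact cj_cj x
  rwa [e, List.map_id] at this

lemma mountX {E F : List ℂ} {e f' f g : ℂ} (h : PT (e :: E) (F ++ [f', f]) [g]) (hE : 1 ≤ E.length)
    (hF : 1 ≤ F.length) (hB : 0 < crs (f + g) e) (a : ℂ) :
    Good (verts a ((e :: E) ++ (F ++ [f', f]) ++ [g])) := by
  refine ⟨a, _, _, _, h.M1 hB, by simpa using hE, by simpa using hF, by simp, ?_⟩
  simp only [verts_append, List.append_assoc]
  refine List.Perm.append_left _ (List.Perm.append_left _ ?_)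
  simp only [verts, List.sum_cons, List.sum_nil, List.cons_append, List.nil_append]
  refine List.Perm.cons _ ?_
  have : ∀ x y x' y' : ℂ, x = y' → y = x' → [x, y].Perm [x', y'] := by
    rintro x y _ _ rfl rfl; exact List.Perm.swap _ _ _
  apply this <;> ring

lemma mountY {M : List ℂ} {e1 e2 f1 f2 f g : ℂ} (h : PT [e1, e2] (f1 :: f2 :: (M ++ [f])) [g])
    (h1 : crs (f + g) e1 ≤ 0) (a : ℂ) :
    Good (verts a ([e1, e2] ++ (f1 :: f2 :: (M ++ [f])) ++ [g])) := by
  refine ⟨a, _, _, _, h.Y h1, by simp, by simp, by simp, ?_⟩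
  have hs := h.s
  simp only [List.sum_append, List.sum_cons, List.sum_nil, add_zero] at hs
  simp only [List.cons_append, List.nil_append, verts]
  have x1 : a + (e1 + e2 + f1) = a + e1 + e2 + f1 := by ring
  have x2 : a + (e1 + e2 + f1) + -f1 = a + e1 + e2 := by ring
  have x3 : a + (e1 + e2 + f1) + -f1 + (f1 + f2) = a + e1 + e2 + f1 + f2 := by ring
  rw [x3, x2, x1]
  simp only [verts_append, verts, List.sum_append, List.sum_cons, List.sum_nil]
  have x4 : a + e1 + e2 + f1 + f2 + (M.sum + (f + 0)) + (g + e1) = a + e1 := by linear_combination hs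
  rw [x4]
  refine List.Perm.cons _ ?_
  have : ∀ (b x y c : ℂ) (T : List ℂ), (x :: b :: (T ++ [c, y])).Perm (y :: b :: x :: (T ++ [c])) := by
    intro b x y c T
    have p1 : (x :: b :: (T ++ [c, y])).Perm (x :: b :: y :: (T ++ [c])) := by
      refine List.Perm.cons _ (List.Perm.cons _ ?_)
      have : T ++ [c, y] = (T ++ [c]) ++ [y] := by simp
      rw [this]
      exact List.perm_append_comm
    refine p1.trans ?_
    have : ∀ T : List ℂ, (x :: b :: y :: T).Perm (y :: b :: x :: T) := by
      intro T
      refine (List.Perm.swap _ _ _).trans ?_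
      refine (List.Perm.cons _ (List.Perm.swap _ _ _)).trans ?_
      exact List.Perm.swap _ _ _
    exact this _
  have := this (a + e1 + e2) (a + e1 + e2 + f1) (a + e1)
    (a + e1 + e2 + f1 + f2 + (M.sum + f)) (verts (a + e1 + e2 + f1 + f2) M ++ [a + e1 + e2 + f1 + f2 + M.sum])
  simpa using this

lemma mount0 {E F : List ℂ} {e f g : ℂ} (h : PT (e :: E) (F ++ [f]) [g]) (hE : 1 ≤ E.length)
    (hF : 2 ≤ F.length) (hB : 0 < crs (f + g) e ∨ E.length = 1) (a : ℂ) :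
    Good (verts a ((e :: E) ++ (F ++ [f]) ++ [g])) := by
  by_cases hB' : 0 < crs (f + g) e
  · obtain ⟨F', f', rfl⟩ : ∃ F' f', F = F' ++ [f'] := by
      rcases List.eq_nil_or_concat F with rfl | ⟨F', f', h⟩
      · simp at hF
      · exact ⟨F', f', by rw [h, List.concat_eq_append]⟩
    have := mountX (F := F') (f' := f') (by simpa using h) hE (by simp at hF; omega) hB' a
    simpa using this
  · obtain ⟨e2, rfl⟩ := List.length_eq_one_iff.1 (hB.resolve_left hB')
    obtain ⟨f1, f2, M, rfl⟩ : ∃ f1 f2 M, F = f1 :: f2 :: M := by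
      match F, hF with
      | f1 :: f2 :: M, _ => exact ⟨f1, f2, M, rfl⟩
    have := mountY (M := M) (by simpa using h) (not_lt.1 hB') a
    simpa using this

lemma mount1 {E F : List ℂ} {e f g : ℂ} (h : PT (e :: E) (F ++ [f]) [g]) (hE : 1 ≤ E.length)
    (hF : 1 ≤ F.length) (hEF : 3 ≤ E.length + F.length) (a : ℂ) :
    Good (verts a ((e :: E) ++ (F ++ [f]) ++ [g])) := by
  by_cases h1 : 2 ≤ F.length ∧ (0 < crs (f + g) e ∨ E.length = 1)
  · exact mount0 h hE h1.1 h1.2 a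
  have h2 : 2 ≤ E.length ∧ (0 < crs f (g + e) ∨ F.length = 1) := by
    by_cases hF2 : 2 ≤ F.length
    · have h3 : ¬ (0 < crs (f + g) e ∨ E.length = 1) := fun h' => h1 ⟨hF2, h'⟩
      push Not at h3
      refine ⟨by omega, Or.inl (h.imposs ?_ ?_ h3.1)⟩
      · rintro rfl; simp at hE
      · rintro rfl; simp at hF
    · exact ⟨by omega, Or.inr (by omega)⟩
  have hm := h.mir
  have m1 : mir (F ++ [f]) = -cj f :: mir F := by simp [mir]
  have m2 : mir (e :: E) = mir E ++ [-cj e] := by simp [mir]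
  have m3 : mir [g] = [-cj g] := by simp [mir]
  rw [m1, m2, m3] at hm
  have key : ∀ b, Good (verts b ((-cj f :: mir F) ++ (mir E ++ [-cj e]) ++ [-cj g])) := by
    intro b
    apply mount0 hm (by rwa [mir_length]) (by rw [mir_length]; exact h2.1)
    rcases h2.2 with h3 | h3
    · left
      have : -cj e + -cj g = -cj (g + e) := by rw [cj_add]; ring
      rw [this, crs_cj]; exact h3
    · right; rw [mir_length]; exact h3
  apply Good.of_mir
  refine (hm.rot.rot.good_rot (cj a) key).perm ?_
  rw [← m1, ← m2, ← m3, List.append_assoc, ← mir_append, ← mir_append]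
  refine verts_mir _ a ?_
  rw [List.sum_append, List.sum_append]; exact h.s

lemma mount {L1 L2 : List ℂ} {g : ℂ} (h : PT L1 L2 [g]) (h1 : 2 ≤ L1.length) (h2 : 2 ≤ L2.length)
    (h3 : 5 ≤ L1.length + L2.length) (a : ℂ) : Good (verts a (L1 ++ L2 ++ [g])) := by
  obtain ⟨e, E, rfl⟩ : ∃ e E, L1 = e :: E := by
    match L1, h1 with
    | e :: E, _ => exact ⟨e, E, rfl⟩
  obtain ⟨F, f, rfl⟩ : ∃ F f, L2 = F ++ [f] := by
    rcases List.eq_nil_or_concat L2 with rfl | ⟨F', f', h⟩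
    · simp at h2
    · exact ⟨F', f', by rw [h, List.concat_eq_append]⟩
  simp at h1 h2 h3
  exact mount1 h h1 h2 (by omega) a

lemma fan {L2 : List ℂ} {e g : ℂ} (h : PT [e] L2 [g]) (h2 : 4 ≤ L2.length) (a : ℂ) :
    Good (verts a ([e] ++ L2 ++ [g])) := by
  obtain ⟨F0, f, rfl⟩ : ∃ F f, L2 = F ++ [f] := by
    rcases List.eq_nil_or_concat L2 with rfl | ⟨F', f', h⟩
    · simp at h2
    · exact ⟨F', f', by rw [h, List.concat_eq_append]⟩
  obtain ⟨F, f', rfl⟩ : ∃ F' f', F0 = F' ++ [f'] := by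
    rcases List.eq_nil_or_concat F0 with rfl | ⟨F', f', h⟩
    · simp at h2
    · exact ⟨F', f', by rw [h, List.concat_eq_append]⟩
  have hA := h.lemA' (by simp) (by simp)
  have hB : 0 < crs (f + g) e := by
    have := sum_pos_l (f + g) (F ++ [f']) (by simp) (fun x hx => by
      have := hA x (by simp only [List.mem_append] at hx ⊢; tauto)
      simpa using this)
    have hs := h.s
    simp only [List.sum_append, List.sum_cons, List.sum_nil, add_zero] at hs this
    have he : e = -((F.sum + f') + (f + g)) := by linear_combination hs
    rw [he, crs_neg_right, crs_add_right, crs_self, add_zero, ← crs_swap]; exact this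
  have h' : PT [e] (F ++ [f', f]) [g] := by simpa using h
  have hM := h'.M1 hB
  have key := hM.good_rot a (fun b => mount hM.rot (by simp at h2 ⊢; omega) (by simp) (by simp at h2 ⊢; omega) b)
  refine key.perm ?_
  have e1 : [e] ++ (F ++ [f'] ++ [f]) ++ [g] = [e] ++ (F ++ [f', f]) ++ [g] := by simp
  rw [e1]
  simp only [verts_append, List.append_assoc]
  refine List.Perm.append_left _ (List.Perm.append_left _ ?_)
  simp only [verts, List.sum_cons, List.sum_nil, List.cons_append, List.nil_append]
  refine List.Perm.cons _ ?_
  have : ∀ x y x' y' : ℂ, x = y' → y = x' → [x, y].Perm [x', y'] := by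
    rintro x y _ _ rfl rfl; exact List.Perm.swap _ _ _
  apply this <;> ring

lemma PT.good {L1 L2 L3 : List ℂ} (h : PT L1 L2 L3) (h1 : 1 ≤ L1.length) (h2 : 1 ≤ L2.length)
    (h3 : 1 ≤ L3.length) (hn : 6 ≤ L1.length + L2.length + L3.length) (a : ℂ) :
    Good (verts a (L1 ++ L2 ++ L3)) := by
  have A : ∀ {L1 L2 L3 : List ℂ}, PT L1 L2 L3 → 2 ≤ L1.length → 2 ≤ L2.length → L3.length = 1 →
      6 ≤ L1.length + L2.length + L3.length → ∀ a, Good (verts a (L1 ++ L2 ++ L3)) := by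
    intro L1 L2 L3 h h1 h2 h3 h4 a
    obtain ⟨g, rfl⟩ := List.length_eq_one_iff.1 h3
    exact mount h h1 h2 (by omega) a
  have B : ∀ {L1 L2 L3 : List ℂ}, PT L1 L2 L3 → L1.length = 1 → L3.length = 1 →
      6 ≤ L1.length + L2.length + L3.length → ∀ a, Good (verts a (L1 ++ L2 ++ L3)) := by
    intro L1 L2 L3 h h1 h3 h4 a
    obtain ⟨g, rfl⟩ := List.length_eq_one_iff.1 h3
    obtain ⟨e, rfl⟩ := List.length_eq_one_iff.1 h1
    exact fan h (by omega) a
  by_cases c1 : L1.length = 1 <;> by_cases c2 : L2.length = 1 <;> by_cases c3 : L3.length = 1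
  · omega
  · exact h.good_rot a (fun b => B h.rot c2 c1 (by omega) b)
  · exact B h c1 c3 (by omega) a
  · exact h.good_rot a (fun b => A h.rot (by omega) (by omega) c1 (by omega) b)
  · exact h.good_rot a (fun b => h.rot.good_rot b (fun c => B h.rot.rot c3 c2 (by omega) c))
  · exact h.good_rot a (fun b => h.rot.good_rot b (fun c => A h.rot.rot (by omega) (by omega) c2 (by omega) c))
  · exact A h (by omega) (by omega) c3 (by omega) a
  · exact ⟨a, L1, L2, L3, h, by omega, by omega, by omega, List.Perm.refl _⟩

end Part10

section Part11
lemma mem_verts (x : ℂ) (L : List ℂ) (a : ℂ) :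
    x ∈ verts a L ↔ ∃ i, i < L.length ∧ x = a + (L.take i).sum := by
  induction L generalizing a with
  | nil => simp [verts]
  | cons d L ih =>
    rw [verts, List.mem_cons, ih]
    constructor
    · rintro (rfl | ⟨i, hi, rfl⟩)
      · exact ⟨0, by simp, by simp⟩
      · exact ⟨i + 1, by simpa using hi, by simp; ring⟩
    · rintro ⟨i, hi, rfl⟩
      cases i with
      | zero => left; simp
      | succ i => right; exact ⟨i, by simpa using hi, by simp; ring⟩

/-- consecutive edge vectors as a list. -/
def el (V : ℕ → ℂ) (k m : ℕ) : List ℂ := (List.range m).map (fun i => dd V (k + i))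

lemma el_length (V : ℕ → ℂ) (k m : ℕ) : (el V k m).length = m := by simp [el]

lemma el_sum (V : ℕ → ℂ) (k m : ℕ) : (el V k m).sum = V (k + m) - V k := by
  induction m with
  | zero => simp [el]
  | succ m ih =>
    have : el V k (m + 1) = el V k m ++ [dd V (k + m)] := by simp [el, List.range_succ]
    rw [this, List.sum_append, ih]; simp [dd, add_assoc]

lemma el_verts (V : ℕ → ℂ) (k m : ℕ) : verts (V k) (el V k m) = (List.range m).map (fun i => V (k + i)) := by
  induction m with
  | zero => simp [el, verts]
  | succ m ih =>
    have : el V k (m + 1) = el V k m ++ [dd V (k + m)] := by simp [el, List.range_succ]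
    rw [this, verts_append, ih, el_sum, List.range_succ, List.map_append]
    simp [verts]

lemma el_neg {V : ℕ → ℂ} {k p q : ℕ} (h : HP (dd V) k p q) : (el V k p).Pairwise (fun a b => crs a b < 0) := by
  unfold el
  rw [List.pairwise_map]
  refine List.Pairwise.imp_of_mem (fun {a b} _ hb hab => ?_) (List.pairwise_lt_range)
  exact h.neg a b hab (List.mem_range.1 hb)

lemma el_pos {V : ℕ → ℂ} {k p q : ℕ} (h : HP (dd V) k p q) :
    ∀ e ∈ el V k p, ∀ f ∈ el V (k + p) q, 0 < crs e f := by
  intro e he f hf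
  unfold el at he hf
  rw [List.mem_map] at he hf
  obtain ⟨i, hi, rfl⟩ := he
  obtain ⟨j, hj, rfl⟩ := hf
  exact h.pos i j (List.mem_range.1 hi) (List.mem_range.1 hj)

lemma toPT {N : ℕ} {V : ℕ → ℂ} {k p q r : ℕ} (hper : ∀ i, V (i + (N + 3)) = V i) (hn : p + q + r = N + 3)
    (h1 : HP (dd V) k p q) (h2 : HP (dd V) (k + p) q r) (h3 : HP (dd V) (k + p + q) r p) :
    PT (el V k p) (el V (k + p) q) (el V (k + p + q) r) := by
  have e : el V (k + p + q + r) p = el V k p := by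
    unfold el
    apply List.map_congr_left
    intro i _
    unfold dd
    rw [show k + p + q + r + i = k + i + (N + 3) by omega, show k + i + (N + 3) + 1 = k + i + 1 + (N + 3) by omega,
      hper, hper]
  refine ⟨?_, el_neg h1, el_neg h2, el_neg h3, el_pos h1, el_pos h2, ?_⟩
  · rw [el_sum, el_sum, el_sum, show k + p + q + r = k + (N + 3) by omega, hper]; ring
  · have := el_pos h3
    rwa [e] at this

lemma toPT_verts {N : ℕ} {V : ℕ → ℂ} {k p q r : ℕ} (hn : p + q + r = N + 3) (x : ℂ) :
    x ∈ verts (V k) (el V k p ++ el V (k + p) q ++ el V (k + p + q) r) ↔ ∃ i, i < N + 3 ∧ V (k + i) = x := by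
  rw [verts_append, verts_append, List.sum_append, el_sum, el_sum]
  have e1 : V k + (V (k + p) - V k) = V (k + p) := by ring
  have e2 : V k + (V (k + p) - V k + (V (k + p + q) - V (k + p))) = V (k + p + q) := by ring
  rw [e1, e2, el_verts, el_verts, el_verts]
  simp only [List.mem_append, List.mem_map, List.mem_range]
  constructor
  · rintro ((⟨i, hi, rfl⟩ | ⟨i, hi, rfl⟩) | ⟨i, hi, rfl⟩)
    · exact ⟨i, by omega, rfl⟩
    · exact ⟨p + i, by omega, by rw [add_assoc]⟩
    · exact ⟨p + q + i, by omega, by simp only [add_assoc]⟩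
  · rintro ⟨i, hi, rfl⟩
    rcases lt_or_ge i p with h | h
    · exact Or.inl (Or.inl ⟨i, h, rfl⟩)
    rcases lt_or_ge i (p + q) with h' | h'
    · exact Or.inl (Or.inr ⟨i - p, by omega, by congr 1; omega⟩)
    · exact Or.inr ⟨i - (p + q), by omega, by congr 1; omega⟩

/-- periodic vertex sequence of a list of edge vectors. -/
def wq (a : ℂ) (L : List ℂ) (n m : ℕ) : ℂ := a + (L.take (m % n)).sum

lemma wq_per (a : ℂ) (L : List ℂ) (n m : ℕ) : wq a L n (m + n) = wq a L n m := by
  unfold wq; rw [Nat.add_mod_right]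

lemma wq_dd (a : ℂ) (L : List ℂ) (n m : ℕ) (hL : L.length = n) (hs : L.sum = 0) (hm : m < n) :
    dd (wq a L n) m = L.getD m 0 := by
  have hm' : m < L.length := by omega
  have t : (L.take (m + 1)).sum = (L.take m).sum + L.getD m 0 := by
    rw [List.getD_eq_getElem _ _ hm', List.sum_take_succ]
  unfold dd wq
  rw [Nat.mod_eq_of_lt hm]
  by_cases h : m + 1 < n
  · rw [Nat.mod_eq_of_lt h, t]; ring
  · have h1 : m + 1 = n := by omega
    rw [← h1, Nat.mod_self]
    rw [h1, ← hL, List.take_length, hs] at t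
    simp only [List.take_zero, List.sum_nil]
    linear_combination t

lemma getD_mem {L : List ℂ} {i : ℕ} (h : i < L.length) : L.getD i 0 ∈ L := by
  rw [List.getD_eq_getElem _ _ h]; exact List.getElem_mem h

lemma getD_neg {L : List ℂ} (h : L.Pairwise (fun a b => crs a b < 0)) {i j : ℕ} (hij : i < j)
    (hj : j < L.length) : crs (L.getD i 0) (L.getD j 0) < 0 := by
  rw [List.getD_eq_getElem _ _ (by omega), List.getD_eq_getElem _ _ hj]
  exact List.pairwise_iff_getElem.1 h i j _ _ hij

lemma PT.toHP {L1 L2 L3 : List ℂ} (h : PT L1 L2 L3) (a : ℂ) (n : ℕ)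
    (hn : L1.length + L2.length + L3.length = n) :
    HP (dd (wq a (L1 ++ L2 ++ L3) n)) 0 L1.length L2.length ∧
    HP (dd (wq a (L1 ++ L2 ++ L3) n)) L1.length L2.length L3.length ∧
    HP (dd (wq a (L1 ++ L2 ++ L3) n)) (L1.length + L2.length) L3.length L1.length := by
  set W := wq a (L1 ++ L2 ++ L3) n with hW
  have hl : (L1 ++ L2 ++ L3).length = n := by simp; omega
  have hs : (L1 ++ L2 ++ L3).sum = 0 := by rw [List.sum_append, List.sum_append]; exact h.s
  have d1 : ∀ i, i < L1.length → dd W i = L1.getD i 0 := by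
    intro i hi
    rw [hW, wq_dd _ _ _ _ hl hs (by omega), List.append_assoc, List.getD_append _ _ _ _ hi]
  have d2 : ∀ i, i < L2.length → dd W (L1.length + i) = L2.getD i 0 := by
    intro i hi
    rw [hW, wq_dd _ _ _ _ hl hs (by omega), List.append_assoc, List.getD_append_right _ _ _ _ (by omega),
      List.getD_append _ _ _ _ (by omega)]
    congr 1; omega
  have d3 : ∀ i, i < L3.length → dd W (L1.length + L2.length + i) = L3.getD i 0 := by
    intro i hi
    rw [hW, wq_dd _ _ _ _ hl hs (by omega), List.getD_append_right _ _ _ _ (by simp)]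
    congr 1; simp
  have d4 : ∀ i, i < L1.length → dd W (L1.length + L2.length + L3.length + i) = L1.getD i 0 := by
    intro i hi
    rw [← d1 i hi]
    unfold dd
    rw [show L1.length + L2.length + L3.length + i + 1 = i + 1 + n by omega,
      show L1.length + L2.length + L3.length + i = i + n by omega, hW, wq_per, wq_per]
  refine ⟨⟨?_, ?_⟩, ⟨?_, ?_⟩, ⟨?_, ?_⟩⟩
  · intro i j hij hj
    rw [zero_add, zero_add, d1 i (by omega), d1 j hj]; exact getD_neg h.n1 hij hj
  · intro i j hi hj
    rw [zero_add, zero_add, d1 i hi, d2 j hj]; exact h.c12 _ (getD_mem hi) _ (getD_mem hj)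
  · intro i j hij hj
    rw [d2 i (by omega), d2 j hj]; exact getD_neg h.n2 hij hj
  · intro i j hi hj
    rw [d2 i hi, d3 j hj]; exact h.c23 _ (getD_mem hi) _ (getD_mem hj)
  · intro i j hij hj
    rw [d3 i (by omega), d3 j hj]; exact getD_neg h.n3 hij hj
  · intro i j hi hj
    rw [d3 i hi, d4 j hj]; exact h.c31 _ (getD_mem hi) _ (getD_mem hj)

end Part11

section Part12
/-- the sequence of vertices in the complex plane. -/
def pv {N : ℕ} (φ : Pt ≃ₗ[ℝ] ℂ) (v : ZMod (N + 3) → Pt) (m : ℕ) : ℂ := φ (v (m : ZMod (N + 3)))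

lemma pv_per {N : ℕ} (φ : Pt ≃ₗ[ℝ] ℂ) (v : ZMod (N + 3) → Pt) (m : ℕ) :
    pv φ v (m + (N + 3)) = pv φ v m := by
  unfold pv
  rw [Nat.cast_add, ZMod.natCast_self, add_zero]

lemma pv_cross {N : ℕ} {φ : Pt ≃ₗ[ℝ] ℂ} {κ : ℝ} (hφ : ∀ a b, crs (φ a) (φ b) = κ * cross2 a b)
    (v : ZMod (N + 3) → Pt) (m : ℕ) :
    crs (dd (pv φ v) m) (dd (pv φ v) (m + 1)) = κ * vtxCross (N + 3) v ((m + 1 : ℕ) : ZMod (N + 3)) := by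
  unfold dd pv vtxCross
  rw [← map_sub, ← map_sub, hφ]
  push_cast
  rw [add_sub_cancel_right]

lemma pv_area {N : ℕ} {φ : Pt ≃ₗ[ℝ] ℂ} {κ : ℝ} (hφ : ∀ a b, crs (φ a) (φ b) = κ * cross2 a b)
    (v : ZMod (N + 3) → Pt) : AA N (pv φ v) = κ * signedArea (N + 3) v := by
  unfold AA signedArea
  rw [dif_neg (by omega), Finset.mul_sum]
  symm
  refine Finset.sum_bij (fun z _ => z.val) ?_ ?_ ?_ ?_
  · intro z _; simpa using ZMod.val_lt z
  · intro a _ b _ hab; exact ZMod.val_injective _ hab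
  · intro b hb
    exact ⟨(b : ZMod (N + 3)), Finset.mem_univ _, ZMod.val_cast_of_lt (by simpa using hb)⟩
  · intro z _
    unfold pv
    rw [hφ]
    push_cast
    rw [ZMod.natCast_zmod_val]

lemma seg_map (φ : Pt ≃ₗ[ℝ] ℂ) (a b : Pt) : segment ℝ (φ a) (φ b) = Set.image φ (segment ℝ a b) := by
  have := image_segment ℝ φ.toLinearMap.toAffineMap a b
  simpa using this.symm

lemma cast_ne {N i j : ℕ} (h : i < j) (h2 : j < i + (N + 3)) : (i : ZMod (N + 3)) ≠ (j : ZMod (N + 3)) := by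
  intro e
  rw [ZMod.natCast_eq_natCast_iff, Nat.modEq_iff_dvd' h.le] at e
  have := Nat.le_of_dvd (by omega) e
  omega

lemma pv_CP {N : ℕ} {φ : Pt ≃ₗ[ℝ] ℂ} {κ : ℝ} (hφ : ∀ a b, crs (φ a) (φ b) = κ * cross2 a b) (hκ : κ ≠ 0)
    {v : ZMod (N + 3) → Pt} (h : IsSimplePolygon (N + 3) v) (ht : ∀ i, vtxCross (N + 3) v i ≠ 0) :
    CP N (pv φ v) where
  per := pv_per φ v
  dis := by
    intro i j hij hji
    unfold pv
    rw [seg_map, seg_map, Set.disjoint_image_iff φ.injective, Set.disjoint_iff_inter_eq_empty]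
    have := h.nonadj i j (cast_ne (by omega) (by omega)) ?_ ?_
    · push_cast; exact this
    · have := cast_ne (N := N) (i := j + 1) (j := i + (N + 3)) (by omega) (by omega)
      rw [Nat.cast_add i, ZMod.natCast_self, add_zero] at this
      push_cast at this
      exact fun e => this e.symm
    · have := cast_ne (N := N) (i := i + 1) (j := j) (by omega) (by omega)
      push_cast at this
      exact fun e => this e.symm
  turn := by
    intro i
    have := pv_cross hφ v i
    unfold dd at this
    rw [show i + 2 = i + 1 + 1 by rfl, this]
    exact mul_ne_zero hκ (ht _)
  inter := by
    intro i
    have := h.adj i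
    unfold pv
    rw [seg_map, seg_map, ← Set.image_inter φ.injective]
    push_cast
    rw [this, Set.image_singleton]

lemma CP_pv {N : ℕ} {φ : Pt ≃ₗ[ℝ] ℂ} {v : ZMod (N + 3) → Pt} (h : CP N (pv φ v)) (hv : Function.Injective v) :
    IsSimplePolygon (N + 3) v where
  three_le := by omega
  inj := hv
  nonadj := by
    have key : ∀ i j : ZMod (N + 3), i.val < j.val → i ≠ j → i ≠ j + 1 → j ≠ i + 1 →
        segment ℝ (v i) (v (i + 1)) ∩ segment ℝ (v j) (v (j + 1)) = ∅ := by
      intro i j hl h0 h1 h2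
      have hj := ZMod.val_lt j
      have e1 : i.val + 2 ≤ j.val := by
        by_contra hc
        apply h2
        have : j.val = i.val + 1 := by omega
        rw [← ZMod.natCast_zmod_val j, this]; push_cast; rw [ZMod.natCast_zmod_val]
      have e2 : j.val + 2 ≤ i.val + N + 3 := by
        by_contra hc
        apply h1
        have e : j.val + 1 = i.val + (N + 3) := by omega
        have := congrArg (Nat.cast : ℕ → ZMod (N + 3)) e
        rw [Nat.cast_add i.val, ZMod.natCast_self, add_zero] at this
        push_cast at this
        rw [ZMod.natCast_zmod_val, ZMod.natCast_zmod_val] at this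
        exact this.symm
      have := h.dis _ _ e1 e2
      unfold pv at this
      rw [seg_map, seg_map, Set.disjoint_image_iff φ.injective, Set.disjoint_iff_inter_eq_empty] at this
      push_cast at this
      rwa [ZMod.natCast_zmod_val, ZMod.natCast_zmod_val] at this
    intro i j h0 h1 h2
    rcases lt_trichotomy i.val j.val with hl | hl | hl
    · exact key i j hl h0 h1 h2
    · exact absurd (ZMod.val_injective _ hl) h0
    · rw [Set.inter_comm]; exact key j i hl h0.symm h2 h1
  adj := by
    intro i
    have := h.inter i.val
    unfold pv at this
    rw [seg_map, seg_map, ← Set.image_inter φ.injective, ← Set.image_singleton] at this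
    have := φ.injective.image_injective this
    push_cast at this
    rwa [ZMod.natCast_zmod_val] at this

lemma pv_conv {N : ℕ} {φ : Pt ≃ₗ[ℝ] ℂ} {κ : ℝ} (hφ : ∀ a b, crs (φ a) (φ b) = κ * cross2 a b)
    {v : ZMod (N + 3) → Pt} (hA : 0 < AA N (pv φ v)) (m : ℕ) :
    IsConvexVtx (N + 3) v ((m + 1 : ℕ) : ZMod (N + 3)) ↔ 0 < crs (dd (pv φ v) m) (dd (pv φ v) (m + 1)) := by
  rw [pv_cross hφ, IsConvexVtx]
  rw [pv_area hφ] at hA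
  set a := vtxCross (N + 3) v ((m + 1 : ℕ) : ZMod (N + 3))
  set s := signedArea (N + 3) v
  have hκ : 0 < κ ^ 2 := by
    have : κ ≠ 0 := by rintro rfl; simp at hA
    positivity
  have e : (κ * a) * (κ * s) = κ ^ 2 * (a * s) := by ring
  constructor
  · intro h
    have : 0 < (κ * a) * (κ * s) := by rw [e]; positivity
    exact (pos_iff_pos_of_mul_pos this).2 hA
  · intro h
    have : 0 < κ ^ 2 * (a * s) := by rw [← e]; positivity
    exact (pos_iff_pos_of_mul_pos this).1 hκ

lemma pv_card {N : ℕ} {φ : Pt ≃ₗ[ℝ] ℂ} {κ : ℝ} (hφ : ∀ a b, crs (φ a) (φ b) = κ * cross2 a b)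
    {v : ZMod (N + 3) → Pt} (hA : 0 < AA N (pv φ v)) :
    {i : ZMod (N + 3) | IsConvexVtx (N + 3) v i}.ncard =
      ((Finset.range (N + 3)).filter (fun j => 0 < crs (dd (pv φ v) j) (dd (pv φ v) (j + 1)))).card := by
  have e : {i : ZMod (N + 3) | IsConvexVtx (N + 3) v i} = Set.image (fun j : ℕ => ((j + 1 : ℕ) : ZMod (N + 3)))
      (((Finset.range (N + 3)).filter (fun j => 0 < crs (dd (pv φ v) j) (dd (pv φ v) (j + 1))) : Finset ℕ) : Set ℕ) := by
    ext i
    simp only [Set.mem_setOf_eq, Set.mem_image, Finset.coe_filter, Finset.mem_range]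
    constructor
    · intro hi
      have e : (((i - 1).val + 1 : ℕ) : ZMod (N + 3)) = i := by
        push_cast; rw [ZMod.natCast_zmod_val]; ring
      refine ⟨(i - 1).val, ⟨ZMod.val_lt _, ?_⟩, e⟩
      rw [← pv_conv hφ hA, e]; exact hi
    · rintro ⟨j, ⟨_, hj⟩, rfl⟩
      exact (pv_conv hφ hA j).2 hj
  rw [e, Set.ncard_image_of_injOn, Set.ncard_coe_finset]
  intro a ha b hb hab
  simp only [Finset.coe_filter, Finset.mem_range, Set.mem_setOf_eq] at ha hb
  simp only [] at hab
  by_contra hne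
  rcases Nat.lt_or_gt_of_ne hne with hl | hl
  · exact cast_ne (N := N) (i := a + 1) (j := b + 1) (by omega) (by omega) hab
  · exact cast_ne (N := N) (i := b + 1) (j := a + 1) (by omega) (by omega) hab.symm

lemma exists_phi {s : ℝ} (hs : s ≠ 0) : ∃ (φ : Pt ≃ₗ[ℝ] ℂ) (κ : ℝ),
    (∀ a b, crs (φ a) (φ b) = κ * cross2 a b) ∧ 0 < κ * s := by
  rcases lt_or_gt_of_ne hs with h | h
  · refine ⟨Complex.equivRealProdLm.symm.trans Complex.conjAe.toLinearEquiv, -1, ?_, by linarith⟩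
    intro a b
    simp [crs, cross2, Complex.equivRealProdLm]
    ring
  · refine ⟨Complex.equivRealProdLm.symm, 1, ?_, by linarith⟩
    intro a b
    simp [crs, cross2, Complex.equivRealProdLm]

lemma final_aux (N : ℕ) (hN : 6 ≤ N + 3) (v : ZMod (N + 3) → Pt) (hv : IsPseudoTriangle (N + 3) v) :
    ∃ w : ZMod (N + 3) → Pt, Set.range w = Set.range v ∧ IsStandardPseudoTriangle (N + 3) w := by
  obtain ⟨hs, ht, hc⟩ := hv
  have hs0 : signedArea (N + 3) v ≠ 0 := by
    intro h0
    have : {i : ZMod (N + 3) | IsConvexVtx (N + 3) v i} = ∅ := by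
      ext i; simp [IsConvexVtx, h0]
    rw [this] at hc; simp at hc
  obtain ⟨φ, κ, hφ, hκs⟩ := exists_phi hs0
  have hκ : κ ≠ 0 := by rintro rfl; simp at hκs
  have hA : 0 < AA N (pv φ v) := by rw [pv_area hφ]; exact hκs
  have hCP := pv_CP hφ hκ hs ht
  obtain ⟨k, p, q, r, hp, hq, hr, hn, h1, h2, h3⟩ := hCP.forward hA (by rw [← pv_card hφ hA]; exact hc)
  have hPT := toPT (pv_per φ v) hn h1 h2 h3
  have hg := hPT.good (by rw [el_length]; exact hp) (by rw [el_length]; exact hq) (by rw [el_length]; exact hr)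
    (by simp only [el_length]; omega) (pv φ v k)
  obtain ⟨a, L1, L2, L3, hPT', l1, l2, l3, hperm⟩ := hg
  have hlen : L1.length + L2.length + L3.length = N + 3 := by
    have := hperm.length_eq
    simp only [verts_length, List.length_append, el_length] at this
    omega
  set W := wq a (L1 ++ L2 ++ L3) (N + 3) with hW
  set w : ZMod (N + 3) → Pt := fun z => φ.symm (W z.val) with hw
  have hWper : ∀ m, W (m + (N + 3)) = W m := fun m => wq_per _ _ _ _
  have hpw : pv φ w = W := by
    funext m
    simp only [pv, hw, LinearEquiv.apply_symm_apply, ZMod.val_natCast, hW, wq, Nat.mod_mod]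
  obtain ⟨b1, b2, b3⟩ := hPT'.toHP a (N + 3) hlen
  obtain ⟨cW, aW, kW⟩ := HP.backward (by omega) (by omega) (by omega) hlen hWper b1 b2 b3
  have hrange : Set.range w = Set.range v := by
    ext x
    have m1 : x ∈ Set.range w ↔ φ x ∈ verts a (L1 ++ L2 ++ L3) := by
      rw [mem_verts]
      have hl : (L1 ++ L2 ++ L3).length = N + 3 := by simp; omega
      rw [hl]
      constructor
      · rintro ⟨z, rfl⟩
        refine ⟨z.val, ZMod.val_lt z, ?_⟩
        simp only [hw, LinearEquiv.apply_symm_apply, hW, wq, Nat.mod_eq_of_lt (ZMod.val_lt z)]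
      · rintro ⟨i, hi, e⟩
        refine ⟨(i : ZMod (N + 3)), ?_⟩
        simp only [hw, hW, wq, ZMod.val_natCast, Nat.mod_mod, Nat.mod_eq_of_lt hi]
        rw [← e, LinearEquiv.symm_apply_apply]
    have m2 : x ∈ Set.range v ↔ ∃ i, i < N + 3 ∧ pv φ v (k + i) = φ x := by
      constructor
      · rintro ⟨z, rfl⟩
        refine ⟨(z - k).val, ZMod.val_lt _, ?_⟩
        unfold pv
        push_cast
        rw [ZMod.natCast_zmod_val]; congr 2; ring
      · rintro ⟨i, _, e⟩
        exact ⟨_, φ.injective e⟩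
    rw [m1, m2, hperm.mem_iff, toPT_verts hn]
  have hinj : Function.Injective w := by
    have hcard : (Finset.univ.image w).card = (Finset.univ : Finset (ZMod (N + 3))).card := by
      have : Finset.univ.image w = Finset.univ.image v := by
        apply Finset.coe_injective
        simpa using hrange
      rw [this, Finset.card_image_of_injective _ hs.inj]
    have := Finset.card_image_iff.1 hcard
    rw [Finset.coe_univ] at this
    exact Set.injOn_univ.1 this
  rw [← hW] at *
  rw [← hpw] at cW aW kW
  refine ⟨w, hrange, ⟨CP_pv cW hinj, ?_, ?_⟩, ?_⟩
  · intro i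
    have := cW.turn (i - 1).val
    have e := pv_cross hφ w (i - 1).val
    unfold dd at e
    rw [show (i - 1).val + 2 = (i - 1).val + 1 + 1 by rfl, e] at this
    have e2 : (((i - 1).val + 1 : ℕ) : ZMod (N + 3)) = i := by
      push_cast; rw [ZMod.natCast_zmod_val]; ring
    rw [e2] at this
    exact right_ne_zero_of_mul this
  · rw [pv_card hφ aW]
    have : (Finset.range (N + 3)).filter (fun j => 0 < crs (dd (pv φ w) j) (dd (pv φ w) (j + 1))) =
        {L1.length - 1, L1.length + L2.length - 1, L1.length + L2.length + L3.length - 1} := by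
      ext j
      simp only [Finset.mem_filter, Finset.mem_range, Finset.mem_insert, Finset.mem_singleton]
      constructor
      · rintro ⟨hj, h⟩
        have := (kW j hj).1 h
        omega
      · intro h
        have hj : j < N + 3 := by omega
        exact ⟨hj, (kW j hj).2 (by omega)⟩
    rw [this, Finset.card_eq_three]
    exact ⟨_, _, _, by omega, by omega, by omega, rfl⟩
  · intro i hi hi1
    have e2 : (((i - 1).val + 1 : ℕ) : ZMod (N + 3)) = i := by
      push_cast; rw [ZMod.natCast_zmod_val]; ring
    have hj := ZMod.val_lt (i - 1)
    set j := (i - 1).val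
    have e3 : ((j + 1 + 1 : ℕ) : ZMod (N + 3)) = i + 1 := by
      rw [Nat.cast_add (j + 1), e2]; simp
    rw [← e2, pv_conv hφ aW, kW j hj] at hi
    by_cases hlt : j + 1 < N + 3
    · rw [← e3, pv_conv hφ aW, kW (j + 1) hlt] at hi1
      omega
    · have e4 : ((0 + 1 : ℕ) : ZMod (N + 3)) = i + 1 := by
        rw [← e3, show j + 1 + 1 = 0 + 1 + (N + 3) by omega, Nat.cast_add (0 + 1), ZMod.natCast_self, add_zero]
      rw [← e4, pv_conv hφ aW, kW 0 (by omega)] at hi1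
      omega

end Part12

/-- Every `ℓ`-pseudo-triangle with `ℓ ≥ 6` can be re-polygonized on the
same vertex set into a standard `ℓ`-pseudo-triangle. -/
theorem statement_0 (ℓ : ℕ) (hℓ : 6 ≤ ℓ) (v : ZMod ℓ → Pt)
    (hv : IsPseudoTriangle ℓ v) :
    ∃ w : ZMod ℓ → Pt, Set.range w = Set.range v ∧ IsStandardPseudoTriangle ℓ w := by
  obtain ⟨N, rfl⟩ : ∃ N, ℓ = N + 3 := ⟨ℓ - 3, by omega⟩
  exact final_aux N hℓ v hv
end
end

section
/- Let S be a finite planar point set in general position whose convex hull is a triangle (exactly 3 points of S are vertices of the convex hull) and which has at least 2 points of S in the interior of its convex hull. Then some 5 points of S form a 5-pseudo-triangle whose interior contains no point of S. -/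
open Set

noncomputable section

/-- Orientation determinant. -/
def ori (x y z : Pt) : ℝ := (y.1 - x.1) * (z.2 - x.2) - (y.2 - x.2) * (z.1 - x.1)

/-- The points of `S` strictly inside the ccw triangle `abc`. -/
def ins (S : Set Pt) (a b c : Pt) : Set Pt :=
  {x ∈ S | 0 < ori a b x ∧ 0 < ori b c x ∧ 0 < ori c a x}

lemma ori_ne {S : Set Pt} (hgp : GenPos S) {p q r : Pt} (hp : p ∈ S) (hq : q ∈ S) (hr : r ∈ S)
    (h1 : p ≠ q) (h2 : p ≠ r) (h3 : q ≠ r) : ori p q r ≠ 0 := by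
  intro h0
  apply hgp p hp q hq r hr h1 h2 h3
  rw [collinear_iff_of_mem (p₀ := p) (by simp)]
  refine ⟨q - p, ?_⟩
  have key : ∃ t : ℝ, r = t • (q - p) + p := by
    unfold ori at h0
    by_cases hx : q.1 - p.1 = 0
    · have hy : q.2 - p.2 ≠ 0 := by
        intro hy
        exact h1 (Prod.ext (by linarith) (by linarith))
      refine ⟨(r.2 - p.2) / (q.2 - p.2), Prod.ext ?_ ?_⟩
      · have : r.1 - p.1 = 0 := by
          rw [hx] at h0
          have : (q.2 - p.2) * (r.1 - p.1) = 0 := by linarith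
          exact (mul_eq_zero.mp this).resolve_left hy
        simp [hx]; linarith
      · simp; field_simp; ring
    · refine ⟨(r.1 - p.1) / (q.1 - p.1), Prod.ext ?_ ?_⟩
      · simp; field_simp; ring
      · simp; field_simp; linarith
  obtain ⟨t, ht⟩ := key
  intro z hz
  simp only [mem_insert_iff, mem_singleton_iff] at hz
  rcases hz with rfl | rfl | rfl
  · exact ⟨0, by simp⟩
  · exact ⟨1, by simp⟩
  · exact ⟨t, by simpa using ht⟩

lemma ori_seg (x y z w : Pt) (s t : ℝ) (h : s + t = 1) :
    ori x y (s • z + t • w) = s * ori x y z + t * ori x y w := by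
  obtain rfl : s = 1 - t := by linarith
  simp [ori]; ring

lemma ori_seg_self {x y z : Pt} (h : z ∈ segment ℝ x y) : ori x y z = 0 := by
  obtain ⟨s, t, hs, ht, hst, rfl⟩ := h
  rw [ori_seg _ _ _ _ _ _ hst]; simp [ori]; ring_nf; simp

lemma ori_seg_pos {x y z w u : Pt} (h : u ∈ segment ℝ z w) (hz : 0 < ori x y z)
    (hw : 0 < ori x y w) : 0 < ori x y u := by
  obtain ⟨s, t, hs, ht, hst, rfl⟩ := h
  rw [ori_seg _ _ _ _ _ _ hst]
  rcases hs.eq_or_lt with rfl | hs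
  · have : t = 1 := by linarith
    subst this; simpa using hw
  · have := mul_pos hs hz
    have := mul_nonneg ht hw.le
    linarith

lemma ori_seg_nonneg {x y z w u : Pt} (h : u ∈ segment ℝ z w) (hz : 0 ≤ ori x y z)
    (hw : 0 ≤ ori x y w) : 0 ≤ ori x y u := by
  obtain ⟨s, t, hs, ht, hst, rfl⟩ := h
  rw [ori_seg _ _ _ _ _ _ hst]
  positivity

lemma ori_swap (x y z : Pt) : ori y x z = - ori x y z := by simp [ori]; ring
lemma ori_rot (x y z : Pt) : ori y z x = ori x y z := by simp [ori]; ring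

lemma seg_disj {x y z w : Pt} (hz : 0 < ori x y z) (hw : 0 < ori x y w) :
    segment ℝ x y ∩ segment ℝ z w = ∅ := by
  ext u
  simp only [mem_inter_iff, mem_empty_iff_false, iff_false, not_and]
  intro h1 h2
  have := ori_seg_self h1
  have := ori_seg_pos h2 hz hw
  linarith

lemma seg_adj {x y z : Pt} (h : ori x y z ≠ 0) :
    segment ℝ x y ∩ segment ℝ y z = {y} := by
  ext u
  simp only [mem_inter_iff, mem_singleton_iff]
  constructor
  · rintro ⟨h1, s, t, hs, ht, hst, rfl⟩
    have := ori_seg_self h1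
    rw [ori_seg _ _ _ _ _ _ hst] at this
    have h0 : ori x y y = 0 := by simp [ori]; ring
    rw [h0] at this
    have : t = 0 := by
      rcases mul_eq_zero.mp (by linarith : t * ori x y z = 0) with h' | h'
      · exact h'
      · exact absurd h' h
    subst this
    have : s = 1 := by linarith
    subst this; simp
  · rintro rfl
    exact ⟨right_mem_segment _ _ _, left_mem_segment _ _ _⟩

/-- A point from which a ray avoids the boundary is not in the interior. -/
lemma not_interior_of_ray {n : ℕ} {v : ZMod n → Pt} {x d : Pt} (hd : d ≠ 0)
    (h : ∀ t : ℝ, 0 ≤ t → x + t • d ∉ polyBoundary n v) : x ∉ polyInterior n v := by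
  rintro ⟨-, hb⟩
  set R : Set Pt := (fun t : ℝ => x + t • d) '' Ici 0 with hR
  have hconn : IsPreconnected R :=
    isPreconnected_Ici.image _ (by fun_prop)
  have hx : x ∈ R := ⟨0, by simp, by simp⟩
  have hsub : R ⊆ (polyBoundary n v)ᶜ := by
    rintro _ ⟨t, ht, rfl⟩
    exact h t ht
  have hRb := hb.subset (hconn.subset_connectedComponentIn hx hsub)
  obtain ⟨C, hC⟩ := hRb.exists_norm_le
  have hdn : 0 < ‖d‖ := norm_pos_iff.mpr hd
  have hC0 : 0 ≤ C := le_trans (norm_nonneg _) (hC x hx)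
  have hle := hC (x + ((C + ‖x‖ + 1) / ‖d‖) • d)
    ⟨(C + ‖x‖ + 1) / ‖d‖, by simp only [mem_Ici]; positivity, rfl⟩
  have h1 : ‖((C + ‖x‖ + 1) / ‖d‖) • d‖ = C + ‖x‖ + 1 := by
    rw [norm_smul, Real.norm_of_nonneg (by positivity)]
    field_simp
  have h2 : ‖((C + ‖x‖ + 1) / ‖d‖) • d‖ ≤ ‖x + ((C + ‖x‖ + 1) / ‖d‖) • d‖ + ‖x‖ := by
    have := norm_sub_le (x + ((C + ‖x‖ + 1) / ‖d‖) • d) x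
    simpa using this
  linarith

lemma zmod5 (i : ZMod 5) : i = 0 ∨ i = 1 ∨ i = 2 ∨ i = 3 ∨ i = 4 := by
  revert i; decide

/-- The mountain with vertices `a b q r c`. -/
def mtn (a b q r c : Pt) : ZMod 5 → Pt := (![a, b, q, r, c] : Fin 5 → Pt)

lemma bary (a b c q r : Pt) :
    ori b c q * ori q r a + ori c a q * ori q r b + ori a b q * ori q r c = 0 := by
  simp [ori]; ring

lemma boundary_mtn {a b q r c u : Pt} (h : u ∈ polyBoundary 5 (mtn a b q r c)) :
    u ∈ segment ℝ a b ∨ u ∈ segment ℝ b q ∨ u ∈ segment ℝ q r ∨ u ∈ segment ℝ r c ∨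
      u ∈ segment ℝ c a := by
  simp only [polyBoundary, mem_iUnion] at h
  obtain ⟨i, hi⟩ := h
  rcases zmod5 i with rfl | rfl | rfl | rfl | rfl
  · exact Or.inl hi
  · exact Or.inr (Or.inl hi)
  · exact Or.inr (Or.inr (Or.inl hi))
  · exact Or.inr (Or.inr (Or.inr (Or.inl hi)))
  · exact Or.inr (Or.inr (Or.inr (Or.inr hi)))

/-- A point beyond the line `xy` having the whole boundary on its nonnegative side. -/
lemma outside {n : ℕ} {v : ZMod n → Pt} {x y u : Pt}
    (hB : ∀ w ∈ polyBoundary n v, 0 ≤ ori x y w) (hu : ori x y u < 0) :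
    u ∉ polyInterior n v := by
  have hne : (y.2 - x.2, -(y.1 - x.1)) ≠ (0 : Pt) := by
    intro h
    have h1 : y.2 - x.2 = 0 := congrArg Prod.fst h
    have h2 : -(y.1 - x.1) = 0 := congrArg Prod.snd h
    have h3 : y.1 - x.1 = 0 := by linarith
    unfold ori at hu
    rw [h1, h3] at hu
    simp at hu
  refine not_interior_of_ray hne ?_
  intro t ht hmem
  have h0 := hB _ hmem
  have : ori x y (u + t • (y.2 - x.2, -(y.1 - x.1))) =
      ori x y u - t * ((y.1 - x.1)^2 + (y.2 - x.2)^2) := by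
    simp [ori]; ring
  have h2 : 0 ≤ t * ((y.1 - x.1)^2 + (y.2 - x.2)^2) := by positivity
  linarith

lemma mountain {S : Set Pt} (hgp : GenPos S) {a b c q r : Pt} (ha : a ∈ S) (hb : b ∈ S)
    (hc : c ∈ S) (habc : 0 < ori a b c) (hq : q ∈ ins S a b c) (hr : r ∈ ins S a b c)
    (hb' : ori q r b < 0) (hc' : ori q r c < 0)
    (hin : ∀ x ∈ ins S a b c, x = q ∨ x = r ∨
      (ori b q x < 0 ∧ ori q r x < 0 ∧ ori r c x < 0)) :
    HasEmptyPseudoTriangle 5 S := by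
  obtain ⟨hqS, q1, q2, q3⟩ := hq
  obtain ⟨hrS, r1, r2, r3⟩ := hr
  have qra : 0 < ori q r a := by
    have := bary a b c q r
    have h1 := mul_pos q3 (neg_pos.mpr hb')
    have h2 := mul_pos q1 (neg_pos.mpr hc')
    have h3 : 0 < ori b c q * ori q r a := by linarith
    exact (pos_iff_pos_of_mul_pos h3).mp q2
  have hbca : 0 < ori b c a := by rwa [ori_rot]
  have hcab : 0 < ori c a b := by rwa [ori_rot, ori_rot]
  have z1 : ori a b a = 0 := by simp [ori]
  have z2 : ori a b b = 0 := by simp [ori]; ring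
  have z3 : ori b c b = 0 := by simp [ori]
  have z4 : ori b c c = 0 := by simp [ori]; ring
  have z5 : ori c a c = 0 := by simp [ori]
  have z6 : ori c a a = 0 := by simp [ori]; ring
  have t0 : 0 < vtxCross 5 (mtn a b q r c) 0 := by
    have : vtxCross 5 (mtn a b q r c) 0 = ori c a b := by
      change cross2 (a - c) (b - a) = _
      simp [cross2, ori]; ring
    rw [this]; exact hcab
  have t1 : 0 < vtxCross 5 (mtn a b q r c) 1 := by
    have : vtxCross 5 (mtn a b q r c) 1 = ori a b q := by
      change cross2 (b - a) (q - b) = _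
      simp [cross2, ori]; ring
    rw [this]; exact q1
  have t2 : vtxCross 5 (mtn a b q r c) 2 < 0 := by
    have : vtxCross 5 (mtn a b q r c) 2 = ori q r b := by
      change cross2 (q - b) (r - q) = _
      simp [cross2, ori]; ring
    rw [this]; exact hb'
  have t3 : vtxCross 5 (mtn a b q r c) 3 < 0 := by
    have : vtxCross 5 (mtn a b q r c) 3 = ori q r c := by
      change cross2 (r - q) (c - r) = _
      simp [cross2, ori]; ring
    rw [this]; exact hc'
  have t4 : 0 < vtxCross 5 (mtn a b q r c) 4 := by
    have : vtxCross 5 (mtn a b q r c) 4 = ori c a r := by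
      change cross2 (c - r) (a - c) = _
      simp [cross2, ori]; ring
    rw [this]; exact r3
  have hA : 0 < signedArea 5 (mtn a b q r c) := by
    have : signedArea 5 (mtn a b q r c) = ori a b q + ori q r a + ori c a r := by
      have : signedArea 5 (mtn a b q r c) =
          cross2 a b + cross2 b q + cross2 q r + cross2 r c + cross2 c a := by
        unfold signedArea
        rw [dif_neg (by norm_num)]
        exact Fin.sum_univ_five (fun i : Fin 5 => cross2 (mtn a b q r c i) (mtn a b q r c (i + 1 : Fin 5)))
      rw [this]
      simp [cross2, ori]; ring
    rw [this]; positivity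
  refine ⟨mtn a b q r c, ?_, ⟨⟨by norm_num, ?_, ?_, ?_⟩, ?_, ?_⟩, ?_⟩
  · rintro _ ⟨i, rfl⟩
    rcases zmod5 i with rfl | rfl | rfl | rfl | rfl
    exacts [ha, hb, hqS, hrS, hc]
  · have ab : a ≠ b := by rintro rfl; simp [ori] at habc
    have ac : a ≠ c := by rintro rfl; simp [ori] at habc
    have bc : b ≠ c := by rintro rfl; linarith
    have qa : q ≠ a := by rintro rfl; linarith
    have qb : q ≠ b := by rintro rfl; linarith
    have qc : q ≠ c := by rintro rfl; linarith
    have ra : r ≠ a := by rintro rfl; linarith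
    have rb : r ≠ b := by rintro rfl; linarith
    have rc : r ≠ c := by rintro rfl; linarith
    have qr : q ≠ r := by rintro rfl; simp [ori] at qra
    intro i j hij
    rcases zmod5 i with rfl | rfl | rfl | rfl | rfl <;>
    rcases zmod5 j with rfl | rfl | rfl | rfl | rfl <;>
    first
    | rfl
    | exact absurd hij ab
    | exact absurd hij ac
    | exact absurd hij bc
    | exact absurd hij qa
    | exact absurd hij qb
    | exact absurd hij qc
    | exact absurd hij ra
    | exact absurd hij rb
    | exact absurd hij rc
    | exact absurd hij qr
    | exact absurd hij.symm ab
    | exact absurd hij.symm ac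
    | exact absurd hij.symm bc
    | exact absurd hij.symm qa
    | exact absurd hij.symm qb
    | exact absurd hij.symm qc
    | exact absurd hij.symm ra
    | exact absurd hij.symm rb
    | exact absurd hij.symm rc
    | exact absurd hij.symm qr
  · have d02 : segment ℝ a b ∩ segment ℝ q r = ∅ := seg_disj q1 r1
    have d03 : segment ℝ a b ∩ segment ℝ r c = ∅ := seg_disj r1 habc
    have d13 : segment ℝ b q ∩ segment ℝ r c = ∅ := by
      rw [segment_symm ℝ b q]
      apply seg_disj
      · simp only [ori] at hb' ⊢; linarith
      · simp only [ori] at q2 ⊢; linarith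
    have d41 : segment ℝ c a ∩ segment ℝ b q = ∅ := seg_disj hcab q3
    have d42 : segment ℝ c a ∩ segment ℝ q r = ∅ := seg_disj q3 r3
    intro i j h1 h2 h3
    rcases zmod5 i with rfl | rfl | rfl | rfl | rfl <;>
    rcases zmod5 j with rfl | rfl | rfl | rfl | rfl <;>
    first
    | exact absurd rfl h1
    | exact absurd rfl h2
    | exact absurd rfl h3
    | exact d02
    | exact d03
    | exact d13
    | exact d41
    | exact d42
    | exact (inter_comm _ _).trans d02
    | exact (inter_comm _ _).trans d03
    | exact (inter_comm _ _).trans d13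
    | exact (inter_comm _ _).trans d41
    | exact (inter_comm _ _).trans d42
  · intro i
    rcases zmod5 i with rfl | rfl | rfl | rfl | rfl
    · exact seg_adj (x := a) (y := b) (z := q) q1.ne'
    · exact seg_adj (x := b) (y := q) (z := r) (by rw [← ori_rot]; exact hb'.ne)
    · exact seg_adj (x := q) (y := r) (z := c) hc'.ne
    · exact seg_adj (x := r) (y := c) (z := a) (by rw [← ori_rot]; exact r3.ne')
    · exact seg_adj (x := c) (y := a) (z := b) hcab.ne'
  · intro i
    rcases zmod5 i with rfl | rfl | rfl | rfl | rfl
    exacts [t0.ne', t1.ne', t2.ne, t3.ne, t4.ne']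
  · have : {i : ZMod 5 | IsConvexVtx 5 (mtn a b q r c) i} = {0, 1, 4} := by
      ext i
      simp only [mem_ofPred_eq, mem_insert_iff, mem_singleton_iff, IsConvexVtx]
      rw [mul_pos_iff_of_pos_right hA]
      rcases zmod5 i with rfl | rfl | rfl | rfl | rfl
      · exact iff_of_true t0 (by decide)
      · exact iff_of_true t1 (by decide)
      · exact iff_of_false t2.le.not_gt (by decide)
      · exact iff_of_false t3.le.not_gt (by decide)
      · exact iff_of_true t4 (by decide)
    rw [this, Set.ncard_eq_three]
    exact ⟨0, 1, 4, by decide, by decide, by decide, rfl⟩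
  · ext x
    simp only [mem_inter_iff, mem_empty_iff_false, iff_false, not_and]
    intro hxi hxS
    revert hxi
    show x ∉ _
    have hvert : ∀ i, mtn a b q r c i ∉ polyInterior 5 (mtn a b q r c) := by
      intro i h
      exact h.1 (mem_iUnion.mpr ⟨i, left_mem_segment _ _ _⟩)
    by_cases xa : x = a
    · rw [xa]; exact hvert 0
    by_cases xb : x = b
    · rw [xb]; exact hvert 1
    by_cases xc : x = c
    · rw [xc]; exact hvert 4
    by_cases xq : x = q
    · rw [xq]; exact hvert 2
    by_cases xr : x = r
    · rw [xr]; exact hvert 3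
    have ab : a ≠ b := by rintro rfl; simp [ori] at habc
    have ac : a ≠ c := by rintro rfl; simp [ori] at habc
    have bc : b ≠ c := by rintro rfl; linarith
    rcases lt_or_gt_of_ne (ori_ne hgp ha hb hxS ab (Ne.symm xa) (Ne.symm xb)) with h1 | h1
    · refine outside ?_ h1
      intro w hw
      rcases boundary_mtn hw with h | h | h | h | h <;>
        exact ori_seg_nonneg h (by linarith) (by linarith)
    rcases lt_or_gt_of_ne (ori_ne hgp hb hc hxS bc (Ne.symm xb) (Ne.symm xc)) with h2 | h2
    · refine outside ?_ h2
      intro w hw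
      rcases boundary_mtn hw with h | h | h | h | h <;>
        exact ori_seg_nonneg h (by linarith) (by linarith)
    rcases lt_or_gt_of_ne (ori_ne hgp hc ha hxS ac.symm (Ne.symm xc) (Ne.symm xa)) with h3 | h3
    · refine outside ?_ h3
      intro w hw
      rcases boundary_mtn hw with h | h | h | h | h <;>
        exact ori_seg_nonneg h (by linarith) (by linarith)
    rcases hin x ⟨hxS, h1, h2, h3⟩ with h | h | ⟨h4, h5, h6⟩
    · exact absurd h xq
    · exact absurd h xr
    refine not_interior_of_ray (d := x - a) (sub_ne_zero.mpr xa) ?_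
    intro t ht hm
    have e : ∀ y z : Pt, ori y z (x + t • (x - a)) = (1 + t) * ori y z x - t * ori y z a := by
      intro y z; simp [ori]; ring
    rcases boundary_mtn hm with h | h | h | h | h
    · have := ori_seg_self h
      rw [e, z1] at this
      nlinarith
    · have := ori_seg_self h
      have h7 : ori b q a = ori a b q := ori_rot _ _ _
      rw [e, h7] at this
      nlinarith
    · have := ori_seg_self h
      rw [e] at this
      nlinarith
    · have := ori_seg_self h
      have h7 : ori r c a = ori c a r := by rw [← ori_rot]
      rw [e, h7] at this
      nlinarith
    · have := ori_seg_self h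
      rw [e, z6] at this
      nlinarith

lemma ins_rot (S : Set Pt) (a b c : Pt) : ins S b c a = ins S a b c := by
  ext x; simp only [ins, mem_ofPred_eq]; tauto

lemma ins_ne {S : Set Pt} {a b c x : Pt} (h : x ∈ ins S a b c) : x ≠ a ∧ x ≠ b ∧ x ≠ c := by
  obtain ⟨-, h1, h2, h3⟩ := h
  refine ⟨?_, ?_, ?_⟩
  · rintro rfl; simp [ori] at h1
  · rintro rfl; simp [ori] at h2
  · rintro rfl; simp [ori] at h3

lemma bary' (a b c p x y : Pt) :
    ori b c p * ori x y a + ori c a p * ori x y b + ori a b p * ori x y c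
      = ori a b c * ori x y p := by
  simp [ori]; ring

lemma plucker (a b p q r : Pt) :
    ori a b p * ori a q r = ori a b q * ori a p r + ori a b r * ori a q p := by
  simp [ori]; ring

lemma ins_sub {S : Set Pt} {a b c p : Pt} (habc : 0 < ori a b c) (hp : p ∈ ins S a b c) :
    ins S a b p ⊆ ins S a b c := by
  obtain ⟨hpS, p1, p2, p3⟩ := hp
  rintro x ⟨hxS, x1, x2, x3⟩
  have hbca : 0 < ori b c a := by rwa [ori_rot]
  have hcab : 0 < ori c a b := by rwa [ori_rot, ori_rot]
  have z3 : ori b c b = 0 := by simp [ori]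
  have z6 : ori c a a = 0 := by simp [ori]; ring
  refine ⟨hxS, x1, ?_, ?_⟩
  · have h := bary' a b p x b c
    rw [z3] at h
    have h1 := mul_pos x2 hbca
    have h2 := mul_pos x1 p2
    exact (pos_iff_pos_of_mul_pos (by linarith : 0 < ori a b p * ori b c x)).mp p1
  · have h := bary' a b p x c a
    rw [z6] at h
    have h1 := mul_pos x3 hcab
    have h2 := mul_pos x1 p3
    exact (pos_iff_pos_of_mul_pos (by linarith : 0 < ori a b p * ori c a x)).mp p1

lemma two_case {S : Set Pt} (hgp : GenPos S) {a b c q r : Pt} (ha : a ∈ S) (hb : b ∈ S)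
    (hc : c ∈ S) (habc : 0 < ori a b c) (hqr : q ≠ r) (hI : ins S a b c = {q, r}) :
    HasEmptyPseudoTriangle 5 S := by
  have hq : q ∈ ins S a b c := by rw [hI]; simp
  have hr : r ∈ ins S a b c := by rw [hI]; simp
  have hbca : 0 < ori b c a := by rwa [ori_rot]
  have hcab : 0 < ori c a b := by rwa [ori_rot, ori_rot]
  have I2 : ins S b c a = {q, r} := by rw [ins_rot, hI]
  have I3 : ins S c a b = {q, r} := by rw [ins_rot, I2]
  obtain ⟨qa, qb, qc⟩ := ins_ne hq
  obtain ⟨ra, rb, rc⟩ := ins_ne hr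
  have na := ori_ne hgp hq.1 hr.1 ha hqr qa ra
  have nb := ori_ne hgp hq.1 hr.1 hb hqr qb rb
  have nc := ori_ne hgp hq.1 hr.1 hc hqr qc rc
  have key : ∀ a b c : Pt, a ∈ S → b ∈ S → c ∈ S → 0 < ori a b c → ins S a b c = {q, r} →
      (ori q r b < 0 ∧ ori q r c < 0 ∨ 0 < ori q r b ∧ 0 < ori q r c) →
      HasEmptyPseudoTriangle 5 S := by
    intro a b c ha hb hc habc hI h
    have hq : q ∈ ins S a b c := by rw [hI]; simp
    have hr : r ∈ ins S a b c := by rw [hI]; simp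
    rcases h with ⟨h1, h2⟩ | ⟨h1, h2⟩
    · refine mountain hgp ha hb hc habc hq hr h1 h2 ?_
      intro x hx
      rw [hI] at hx
      rcases hx with h | h
      · exact Or.inl h
      · exact Or.inr (Or.inl h)
    · refine mountain hgp ha hb hc habc hr hq (by rw [ori_swap]; linarith)
        (by rw [ori_swap]; linarith) ?_
      intro x hx
      rw [hI] at hx
      rcases hx with h | h
      · exact Or.inr (Or.inl h)
      · exact Or.inl h
  rcases lt_or_gt_of_ne na with h1 | h1 <;> rcases lt_or_gt_of_ne nb with h2 | h2 <;>
    rcases lt_or_gt_of_ne nc with h3 | h3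
  · exact key a b c ha hb hc habc hI (Or.inl ⟨h2, h3⟩)
  · exact key c a b hc ha hb hcab I3 (Or.inl ⟨h1, h2⟩)
  · exact key b c a hb hc ha hbca I2 (Or.inl ⟨h3, h1⟩)
  · exact key a b c ha hb hc habc hI (Or.inr ⟨h2, h3⟩)
  · exact key a b c ha hb hc habc hI (Or.inl ⟨h2, h3⟩)
  · exact key b c a hb hc ha hbca I2 (Or.inr ⟨h3, h1⟩)
  · exact key c a b hc ha hb hcab I3 (Or.inr ⟨h1, h2⟩)
  · exact key a b c ha hb hc habc hI (Or.inr ⟨h2, h3⟩)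

lemma three_case {S : Set Pt} (hgp : GenPos S) {a b c p q r : Pt} (ha : a ∈ S) (hb : b ∈ S)
    (hc : c ∈ S) (habc : 0 < ori a b c)
    (small : ∀ a' b' c' : Pt, a' ∈ S → b' ∈ S → c' ∈ S → 0 < ori a' b' c' →
      ins S a' b' c' = ins S a b c → ∀ p ∈ ins S a' b' c', ∀ y ∈ ins S a' b' p,
        ∀ z ∈ ins S a' b' p, y = z)
    (hp : p ∈ ins S a b c) (hq : q ∈ ins S a b p) (hr : r ∈ ins S c a p)
    (hI : ∀ x ∈ ins S a b c, x = p ∨ x = q ∨ x = r) :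
    HasEmptyPseudoTriangle 5 S := by
  have hbca : 0 < ori b c a := by rwa [ori_rot]
  have hcab : 0 < ori c a b := by rwa [ori_rot, ori_rot]
  have I2 : ins S b c a = ins S a b c := by rw [ins_rot]
  have I3 : ins S c a b = ins S a b c := by rw [ins_rot, I2]
  have hqI : q ∈ ins S a b c := ins_sub habc hp hq
  have hrI : r ∈ ins S a b c := I3 ▸ ins_sub hcab (I3.symm ▸ hp) hr
  obtain ⟨qa, qb, qp⟩ := ins_ne hq
  obtain ⟨rc, ra, rp⟩ := ins_ne hr
  obtain ⟨-, -, qc⟩ := ins_ne hqI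
  obtain ⟨-, rb, -⟩ := ins_ne hrI
  obtain ⟨pa, pb, pc⟩ := ins_ne hp
  obtain ⟨hpS, p1, p2, p3⟩ := id hp
  obtain ⟨hqS, q1, q2, q3⟩ := id hq
  obtain ⟨hrS, r1, r2, r3⟩ := id hr
  obtain ⟨-, q4, q5, q6⟩ := id hqI
  obtain ⟨-, r4, r5, r6⟩ := id hrI
  have hbpr : 0 < ori b p r := by
    rcases lt_or_gt_of_ne (ori_ne hgp hb hpS hrS pb.symm rb.symm rp.symm) with h | h
    · exfalso
      have hpr : p ∈ ins S a b r := ⟨hpS, p1, by simp only [ori] at h ⊢; linarith,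
        by simp only [ori] at r2 ⊢; linarith⟩
      exact qp (small a b c ha hb hc habc rfl r hrI q (ins_sub r4 hpr hq) p hpr)
    · exact h
  have hpcq : 0 < ori p c q := by
    rcases lt_or_gt_of_ne (ori_ne hgp hpS hc hqS pc qp.symm qc.symm) with h | h
    · exfalso
      have hpr : p ∈ ins S c a q := ⟨hpS, p3, by simp only [ori] at q3 ⊢; linarith,
        by simp only [ori] at h ⊢; linarith⟩
      exact rp (small c a b hc ha hb hcab I3 q (I3.symm ▸ hqI) r (ins_sub q6 hpr hr) p hpr)
    · exact h
  have hpr : p ∈ ins S b c r := ⟨hpS, p2, by simp only [ori] at r3 ⊢; linarith,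
    by simp only [ori] at hbpr ⊢; linarith⟩
  have hpq : p ∈ ins S b c q := ⟨hpS, p2, by simp only [ori] at hpcq ⊢; linarith,
    by simp only [ori] at q2 ⊢; linarith⟩
  have hqr : q ≠ r := by
    rintro rfl
    simp only [ori] at q3 r2
    linarith
  have hqn : q ∉ ins S b c r := fun h =>
    qp (small b c a hb hc ha hbca I2 r (I2.symm ▸ hrI) q h p hpr)
  have hrn : r ∉ ins S b c q := fun h =>
    rp (small b c a hb hc ha hbca I2 q (I2.symm ▸ hqI) r h p hpq)
  have nb := ori_ne hgp hqS hrS hb hqr qb rb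
  have nc := ori_ne hgp hqS hrS hc hqr qc rc
  have haqr : 0 < ori q r a := by
    have h := plucker a b p q r
    have h1 : 0 < ori a p r := r2
    have h2 : 0 < ori a q p := by simp only [ori] at q3 ⊢; linarith
    have h3 := mul_pos q1 h1
    have h4 := mul_pos r4 h2
    have h5 : 0 < ori a q r := (pos_iff_pos_of_mul_pos
      (by linarith : 0 < ori a b p * ori a q r)).mp p1
    rwa [ori_rot]
  have e1 : ori c r q = - ori q r c := by simp [ori]; ring
  have e2 : ori r b q = ori q r b := by simp [ori]; ring
  have e3 : ori c q r = ori q r c := by simp [ori]; ring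
  have e4 : ori q b r = - ori q r b := by simp [ori]; ring
  have both : ori q r b < 0 ∧ ori q r c < 0 := by
    rcases lt_or_gt_of_ne nb with h1 | h1 <;> rcases lt_or_gt_of_ne nc with h2 | h2
    · exact ⟨h1, h2⟩
    · exact absurd ⟨hrS, r5, by linarith, by linarith⟩ hrn
    · exact absurd ⟨hqS, q5, by linarith, by linarith⟩ hqn
    · exfalso
      have := bary a b c q r
      have := mul_pos q5 haqr
      have := mul_pos q6 h1
      have := mul_pos q4 h2
      linarith
  refine mountain hgp ha hb hc habc hqI hrI both.1 both.2 ?_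
  intro x hx
  rcases hI x hx with rfl | rfl | rfl
  · right; right
    refine ⟨by simp only [ori] at q2 ⊢; linarith, ?_, by simp only [ori] at r3 ⊢; linarith⟩
    have h := bary' b c r x q r
    have z : ori q r r = 0 := by simp [ori]; ring
    rw [z] at h
    have h1 := mul_pos hpr.2.2.1 (neg_pos.mpr both.1)
    have h2 := mul_pos hpr.2.2.2 (neg_pos.mpr both.2)
    by_contra hneg
    have h3 := mul_nonneg r5.le (not_lt.mp hneg)
    linarith
  · exact Or.inl rfl
  · exact Or.inr (Or.inl rfl)

lemma main_ind {S : Set Pt} (hfin : S.Finite) (hgp : GenPos S) (n : ℕ) :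
    ∀ a b c : Pt, a ∈ S → b ∈ S → c ∈ S → 0 < ori a b c → (ins S a b c).ncard = n → 2 ≤ n →
      HasEmptyPseudoTriangle 5 S := by
  induction n using Nat.strong_induction_on with
  | _ n IH =>
  intro a b c ha hb hc habc hn h2
  have hif : ∀ a b c, (ins S a b c).Finite := fun a b c => hfin.subset (fun x hx => hx.1)
  by_contra hno
  have small : ∀ a' b' c' : Pt, a' ∈ S → b' ∈ S → c' ∈ S → 0 < ori a' b' c' →
      ins S a' b' c' = ins S a b c → ∀ p ∈ ins S a' b' c', ∀ y ∈ ins S a' b' p,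
        ∀ z ∈ ins S a' b' p, y = z := by
    intro a' b' c' ha' hb' hc' hpos heq p hp y hy z hz
    by_contra hyz
    apply hno
    refine IH (ins S a' b' p).ncard ?_ a' b' p ha' hb' hp.1 hp.2.1 rfl ?_
    · rw [← hn, ← heq]
      refine Set.ncard_lt_ncard ⟨ins_sub hpos hp, fun h => ?_⟩ (hif _ _ _)
      exact (ins_ne (h hp)).2.2 rfl
    · exact (Set.one_lt_ncard (hif _ _ _)).mpr ⟨y, hy, z, hz, hyz⟩
  rcases h2.eq_or_lt with h2 | h3
  · rw [← h2, Set.ncard_eq_two] at hn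
    obtain ⟨q, r, hqr, hI⟩ := hn
    exact hno (two_case hgp ha hb hc habc hqr hI)
  have hne : (ins S a b c).Nonempty := by
    rw [← Set.ncard_pos (hif _ _ _)]; omega
  obtain ⟨p, hp, hmin⟩ := Set.exists_min_image (ins S a b c) (fun x => ori b c x) (hif _ _ _) hne
  obtain ⟨pa, pb, pc⟩ := ins_ne hp
  have hcab : 0 < ori c a b := by rwa [ori_rot, ori_rot]
  have I3 : ins S c a b = ins S a b c := by rw [ins_rot, ins_rot]
  have split : ∀ x ∈ ins S a b c, x ≠ p → x ∈ ins S a b p ∨ x ∈ ins S c a p := by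
    intro x hx hxp
    obtain ⟨xa, xb, xc⟩ := ins_ne hx
    have hm := hmin x hx
    obtain ⟨hpS, p1, p2, p3⟩ := id hp
    obtain ⟨hxS, x1, x2, x3⟩ := id hx
    have na := ori_ne hgp hpS hxS ha hxp.symm pa xa
    have nb := ori_ne hgp hpS hxS hb hxp.symm pb xb
    have nc := ori_ne hgp hpS hxS hc hxp.symm pc xc
    have hb0 := bary a b c p x
    have hs : ori b c p = ori b c x + ori p x c - ori p x b := by simp [ori]; ring
    rcases lt_or_gt_of_ne na with h1 | h1
    · left
      refine ⟨hxS, x1, ?_, by simp only [ori] at h1 ⊢; linarith⟩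
      rcases lt_or_gt_of_ne nb with h | h
      · exfalso
        have : 0 < ori p x c := by
          have h5 := mul_pos p2 (neg_pos.mpr h1)
          have h6 := mul_pos p3 (neg_pos.mpr h)
          exact (pos_iff_pos_of_mul_pos (by linarith : 0 < ori a b p * ori p x c)).mp p1
        linarith
      · simp only [ori] at h ⊢; linarith
    · right
      refine ⟨hxS, x3, by simp only [ori] at h1 ⊢; linarith, ?_⟩
      rcases lt_or_gt_of_ne nc with h | h
      · simp only [ori] at h ⊢; linarith
      · exfalso
        have h5 := mul_pos p2 h1
        have h6 := mul_pos p1 h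
        have : ori p x b < 0 := by
          by_contra hneg
          have h7 := mul_nonneg p3.le (not_lt.mp hneg)
          linarith
        linarith
  have ge3 : ∃ y ∈ ins S a b c, ∃ z ∈ ins S a b c, y ≠ p ∧ z ≠ p ∧ y ≠ z := by
    have hc2 : 1 < (ins S a b c \ {p}).ncard := by
      rw [Set.ncard_sdiff_singleton_of_mem hp]; omega
    obtain ⟨y, hy, z, hz, hyz⟩ := (Set.one_lt_ncard ((hif _ _ _).sdiff)).mp hc2
    exact ⟨y, hy.1, z, hz.1, hy.2, hz.2, hyz⟩
  obtain ⟨y, hy, z, hz, hyp, hzp, hyz⟩ := ge3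
  have s1 := small a b c ha hb hc habc rfl p hp
  have s2 := small c a b hc ha hb hcab I3 p (I3.symm ▸ hp)
  have fin : ∀ q ∈ ins S a b p, ∀ r ∈ ins S c a p, False := by
    intro q hq r hr
    refine hno (three_case hgp ha hb hc habc small hp hq hr ?_)
    intro x hx
    by_cases hxp : x = p
    · exact Or.inl hxp
    rcases split x hx hxp with h | h
    · exact Or.inr (Or.inl (s1 x h q hq))
    · exact Or.inr (Or.inr (s2 x h r hr))
  rcases split y hy hyp with h | h <;> rcases split z hz hzp with h' | h'
  · exact hyz (s1 y h z h')
  · exact fin y h z h'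
  · exact fin z h' y h
  · have heq := s2 y h z h'
    exact hyz heq

/-- Hull step: all of `S` lies in the hull of the hull vertices. -/
lemma subset_hull {S : Set Pt} (hfin : S.Finite) :
    convexHull ℝ S ⊆ convexHull ℝ (hullVertices S) := by
  have hext : (convexHull ℝ S).extremePoints ℝ ⊆ hullVertices S := by
    intro p hp
    refine ⟨extremePoints_convexHull_subset hp, fun hmem => ?_⟩
    have := inter_extremePoints_subset_extremePoints_of_subset
      (𝕜 := ℝ) (convexHull_mono (𝕜 := ℝ) (sdiff_subset : S \ {p} ⊆ S)) ⟨hmem, hp⟩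
    exact (extremePoints_convexHull_subset this).2 rfl
  have hcl := closure_convexHull_extremePoints (hfin.isCompact_convexHull (𝕜 := ℝ)) (convex_convexHull ℝ S)
  rw [← hcl]
  have hvf : (hullVertices S).Finite := hfin.subset (fun x hx => hx.1)
  exact closure_minimal (convexHull_mono hext) (hvf.isCompact_convexHull (𝕜 := ℝ)).isClosed

lemma hull_half {a b c x s t : Pt} (hx : x ∈ convexHull ℝ {a, b, c}) (ha : 0 ≤ ori s t a)
    (hb : 0 ≤ ori s t b) (hc : 0 ≤ ori s t c) : 0 ≤ ori s t x := by
  have hconv : Convex ℝ {y : Pt | 0 ≤ ori s t y} := by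
    intro y hy z hz α β hα hβ hαβ
    simp only [mem_ofPred_eq] at *
    rw [ori_seg _ _ _ _ _ _ hαβ]
    positivity
  refine convexHull_min ?_ hconv hx
  rintro y (rfl | rfl | rfl) <;> assumption

lemma int_half {H : Set Pt} {x s t : Pt} (hst : s ≠ t) (hx : x ∈ interior H)
    (h : ∀ y ∈ H, 0 ≤ ori s t y) : 0 < ori s t x := by
  have hcont : ContinuousAt (fun e : ℝ => x + e • ((t.2 - s.2, -(t.1 - s.1)) : Pt)) 0 := by
    fun_prop
  have hev : ∀ᶠ e in nhds (0 : ℝ), x + e • ((t.2 - s.2, -(t.1 - s.1)) : Pt) ∈ H := by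
    apply hcont
    simpa using mem_interior_iff_mem_nhds.mp hx
  obtain ⟨ε, hε, hball⟩ := Metric.eventually_nhds_iff.mp hev
  have h1 := h _ (hball (y := ε / 2) (by
    rw [Real.dist_eq, sub_zero, abs_of_pos (by linarith)]; linarith))
  have h2 : ori s t (x + (ε / 2) • ((t.2 - s.2, -(t.1 - s.1)) : Pt)) =
      ori s t x - (ε / 2) * ((t.1 - s.1)^2 + (t.2 - s.2)^2) := by
    simp [ori]; ring
  have h3 : 0 < (t.1 - s.1)^2 + (t.2 - s.2)^2 := by
    by_contra hle
    have e1 : (t.1 - s.1) = 0 := by nlinarith [sq_nonneg (t.1 - s.1), sq_nonneg (t.2 - s.2)]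
    have e2 : (t.2 - s.2) = 0 := by nlinarith [sq_nonneg (t.1 - s.1), sq_nonneg (t.2 - s.2)]
    exact hst (Prod.ext (by linarith) (by linarith))
  have h4 := mul_pos (half_pos hε) h3
  linarith

lemma final {S : Set Pt} (hfin : S.Finite) (hgp : GenPos S) {a b c : Pt}
    (hV : hullVertices S = {a, b, c}) (habc : 0 < ori a b c)
    (hint : 2 ≤ (interiorPts S).ncard) : HasEmptyPseudoTriangle 5 S := by
  have ha : a ∈ S := (show a ∈ hullVertices S by rw [hV]; simp).1
  have hb : b ∈ S := (show b ∈ hullVertices S by rw [hV]; simp).1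
  have hc : c ∈ S := (show c ∈ hullVertices S by rw [hV]; simp).1
  have hsub := subset_hull hfin
  rw [hV] at hsub
  have hbca : 0 < ori b c a := by rwa [ori_rot]
  have hcab : 0 < ori c a b := by rwa [ori_rot, ori_rot]
  have z1 : ori a b a = 0 := by simp [ori]
  have z2 : ori a b b = 0 := by simp [ori]; ring
  have z3 : ori b c b = 0 := by simp [ori]
  have z4 : ori b c c = 0 := by simp [ori]; ring
  have z5 : ori c a c = 0 := by simp [ori]
  have z6 : ori c a a = 0 := by simp [ori]; ring
  have ab : a ≠ b := by rintro rfl; simp [ori] at habc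
  have ac : a ≠ c := by rintro rfl; simp [ori] at habc
  have bc : b ≠ c := by rintro rfl; linarith
  have hIs : interiorPts S ⊆ ins S a b c := by
    rintro x ⟨hxS, hx⟩
    refine ⟨hxS, int_half ab hx ?_, int_half bc hx ?_, int_half ac.symm hx ?_⟩ <;>
    · intro y hy
      exact hull_half (hsub hy) (by linarith) (by linarith) (by linarith)
  have hif : (ins S a b c).Finite := hfin.subset (fun x hx => hx.1)
  exact main_ind hfin hgp _ a b c ha hb hc habc rfl (hint.trans (Set.ncard_le_ncard hIs hif))

theorem statement_2 (S : Set Pt) (hfin : S.Finite) (hgp : GenPos S)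
    (hhull : (hullVertices S).ncard = 3) (hint : 2 ≤ (interiorPts S).ncard) :
    HasEmptyPseudoTriangle 5 S := by
  obtain ⟨a, b, c, hab, hac, hbc, hV⟩ := Set.ncard_eq_three.mp hhull
  have ha : a ∈ S := (show a ∈ hullVertices S by rw [hV]; simp).1
  have hb : b ∈ S := (show b ∈ hullVertices S by rw [hV]; simp).1
  have hc : c ∈ S := (show c ∈ hullVertices S by rw [hV]; simp).1
  rcases lt_or_gt_of_ne (ori_ne hgp ha hb hc hab hac hbc) with h | h
  · refine final hfin hgp (a := b) (b := a) (c := c) ?_ (by rw [ori_swap]; linarith) hint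
    rw [hV, Set.insert_comm]
  · exact final hfin hgp hV h hint
end
end
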